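/- arXiv:2410.16495 — 4 statements merged into one kernel-verified Lean document; each statement's English description precedes it below -/
import Mathlib

section
/- For all positive integers d, l, l', r, s, s', t there are positive integers f = f(d,l,l',r,s,s',t) and g = g(d,l,l',r,s,s',t) such that for every (f,g)-constellation 𝔠, one of the following holds: (a) 𝔠 has an induced subgraph isomorphic to K_{r,r} or to a proper subdivision of K_{2t+2}; (b) there is a d-ample interrupted (s,l)-constellation which sits in 𝔠; or (c) there is a d-ample 2t-zigzagged (s',l')-constellation which sits in 𝔠. -/
open SimpleGraph

/-- Two vertex sets `X` and `Y` are *anticomplete* in `G` if they are disjoint and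
there is no edge of `G` with an end in each. -/
def Anticomplete {V : Type} (G : SimpleGraph V) (X Y : Set V) : Prop :=
  Disjoint X Y ∧ ∀ x ∈ X, ∀ y ∈ Y, ¬ G.Adj x y

/-- `G` has an induced subgraph isomorphic to `H`. -/
def HasInducedSubgraphIso {V W : Type} (G : SimpleGraph V) (H : SimpleGraph W) : Prop :=
  ∃ X : Set V, Nonempty (H ≃g G.induce X)

/-- `G` has an induced minor isomorphic to `H`, witnessed by branch sets. -/
def HasInducedMinor {V W : Type} (G : SimpleGraph V) (H : SimpleGraph W) : Prop :=
  ∃ B : W → Set V,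
    (∀ w, (G.induce (B w)).Connected) ∧
    (Pairwise fun u v => Disjoint (B u) (B v)) ∧
    (∀ u v : W, u ≠ v → (H.Adj u v ↔ ¬ Anticomplete G (B u) (B v)))

/-- The set `P` induces a path in `G`. -/
def IsPathSet {V : Type} (G : SimpleGraph V) (P : Set V) : Prop :=
  ∃ n : ℕ, Nonempty (G.induce P ≃g pathGraph (n + 1))

/-- The vertex sets of the connected components of the subgraph of `G` induced on `X`. -/
def CompsOn {V : Type} (G : SimpleGraph V) (X : Set V) : Set (Set V) :=
  {L | ∃ C : (G.induce X).ConnectedComponent, L = Subtype.val '' C.supp}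

/-- The induced subgraph of `G` on `W` together with the stable set `S ⊆ W` forms a
constellation: every component of `W \ S` is a path and every vertex of `S` has a
neighbor in every such component. -/
structure IsConstellationOn {V : Type} (G : SimpleGraph V) (W S : Set V) : Prop where
  subset : S ⊆ W
  stable : ∀ x ∈ S, ∀ y ∈ S, ¬ G.Adj x y
  comp_paths : ∀ L ∈ CompsOn G (W \ S), IsPathSet G L
  dominates : ∀ x ∈ S, ∀ L ∈ CompsOn G (W \ S), ∃ y ∈ L, G.Adj x y

/-- `p` is a route of the constellation `(W, S)` in `G`: an induced path of the induced
subgraph of `G` on `W`, with its two (distinct) ends in `S` and its interior outside `S`. -/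
structure IsRoute {V : Type} (G : SimpleGraph V) (W S : Set V) {x y : V}
    (p : G.Walk x y) : Prop where
  ne : x ≠ y
  isPath : p.IsPath
  induced : ∀ u v, u ∈ p.support → v ∈ p.support → G.Adj u v → p.toSubgraph.Adj u v
  support_mem : ∀ v ∈ p.support, v ∈ W
  fst_mem : x ∈ S
  snd_mem : y ∈ S
  interior : ∀ v ∈ p.support, v ≠ x → v ≠ y → v ∉ S

/-- The constellation `(W, S)` in `G` is `d`-ample: no route has length at most `d+1`. -/
def DAmple {V : Type} (G : SimpleGraph V) (W S : Set V) (d : ℕ) : Prop :=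
  ∀ ⦃x y : V⦄ (p : G.Walk x y), IsRoute G W S p → d + 1 < p.length

/-- The constellation `(W, S)` in `G` is interrupted with respect to some linear order
(encoded by an injective-on-`S` function `f : V → ℕ`). -/
def Interrupted {V : Type} (G : SimpleGraph V) (W S : Set V) : Prop :=
  ∃ f : V → ℕ, Set.InjOn f S ∧
    ∀ x ∈ S, ∀ y ∈ S, ∀ z ∈ S, f x < f y → f y < f z →
      ∀ (p : G.Walk x y), IsRoute G W S p → ∃ v ∈ p.support, G.Adj z v

/-- The constellation `(W, S)` in `G` is `q`-zigzagged. -/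
def Zigzagged {V : Type} (G : SimpleGraph V) (W S : Set V) (q : ℕ) : Prop :=
  ∃ f : V → ℕ, Set.InjOn f S ∧
    ∀ x ∈ S, ∀ y ∈ S, f x < f y →
      ∀ (p : G.Walk x y), IsRoute G W S p →
        {z | z ∈ S ∧ f x < f z ∧ f z < f y ∧ ¬ ∃ v ∈ p.support, G.Adj z v}.ncard < q

/-- The constellation `(W, S)` in `G` is `(qm, q, qp)`-mixed. -/
def Mixed {V : Type} (G : SimpleGraph V) (W S : Set V) (qm q qp : ℕ) : Prop :=
  ∃ f : V → ℕ, Set.InjOn f S ∧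
    ∀ x ∈ S, ∀ y ∈ S, f x < f y →
      ∀ (p : G.Walk x y), IsRoute G W S p →
        ∀ Qm Q Qp : Set V, Qm ⊆ S → Q ⊆ S → Qp ⊆ S →
          Qm.ncard = qm → Q.ncard = q → Qp.ncard = qp →
          (∀ z ∈ Qm, f z < f x) → (∀ z ∈ Q, f x < f z ∧ f z < f y) →
          (∀ z ∈ Qp, f y < f z) →
          ∃ z ∈ Qm ∪ Q ∪ Qp, ∃ v ∈ p.support, G.Adj z v

/-- The constellation `(W', S')` sits in the constellation `(W, S)` (both within `G`). -/
def SitsIn {V : Type} (G : SimpleGraph V) (W' S' W S : Set V) : Prop :=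
  W' ⊆ W ∧ S' ⊆ S ∧
  (∀ L ∈ CompsOn G (W' \ S'), ∃ M ∈ CompsOn G (W \ S), L ⊆ M) ∧
  (∀ M ∈ CompsOn G (W \ S), ∀ L₁ ∈ CompsOn G (W' \ S'), ∀ L₂ ∈ CompsOn G (W' \ S'),
      L₁ ⊆ M → L₂ ⊆ M → L₁ = L₂)

/-- A witness that `S` is a subdivision of `H`, where each edge of `H` is replaced by a
path whose length satisfies `ok`. -/
structure SubdivModel {U W : Type} (S : SimpleGraph U) (H : SimpleGraph W)
    (ok : ℕ → Prop) where
  b : W → U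
  b_inj : Function.Injective b
  path : ∀ ⦃u v : W⦄, H.Adj u v → S.Walk (b u) (b v)
  path_isPath : ∀ ⦃u v : W⦄ (h : H.Adj u v), (path h).IsPath
  path_len : ∀ ⦃u v : W⦄ (h : H.Adj u v), ok (path h).length
  path_symm : ∀ ⦃u v : W⦄ (h : H.Adj u v), path h.symm = (path h).reverse
  branch_avoid : ∀ ⦃u v : W⦄ (h : H.Adj u v) (w : W), b w ∈ (path h).support → w = u ∨ w = v
  interiors_anticomplete :
    ∀ ⦃u v u' v' : W⦄ (h : H.Adj u v) (h' : H.Adj u' v'),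
      (s(u, v) : Sym2 W) ≠ s(u', v') →
      ∀ x ∈ (path h).support, x ≠ b u → x ≠ b v →
      ∀ y ∈ (path h').support, y ≠ b u' → y ≠ b v' →
        x ≠ y ∧ ¬ S.Adj x y
  cover : ∀ x : U, (∃ w, x = b w) ∨ ∃ (u v : W) (h : H.Adj u v), x ∈ (path h).support
  edges_eq : ∀ x y : U, S.Adj x y → ∃ (u v : W) (h : H.Adj u v), (path h).toSubgraph.Adj x y

/-- `S` is a subdivision of `H` with path lengths satisfying `ok`. -/
def IsSubdivisionWith {U W : Type} (S : SimpleGraph U) (H : SimpleGraph W)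
    (ok : ℕ → Prop) : Prop :=
  Nonempty (SubdivModel S H ok)

/-- The line graph of `G`. -/
def LineGraph {V : Type} (G : SimpleGraph V) : SimpleGraph G.edgeSet :=
  SimpleGraph.fromRel (fun e f => ∃ v : V, v ∈ (e : Sym2 V) ∧ v ∈ (f : Sym2 V))

/-- The `r`-by-`r` hexagonal wall (brick wall). -/
def Wall (r : ℕ) : SimpleGraph (Fin r × Fin (2 * r)) :=
  SimpleGraph.fromRel (fun a b =>
    (a.1 = b.1 ∧ a.2.val + 1 = b.2.val) ∨
    (a.2 = b.2 ∧ a.1.val + 1 = b.1.val ∧ (a.1.val + a.2.val) % 2 = 0))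

/-- The full binary tree of radius `r`, on `2^(r+1) - 1` vertices (heap indexing). -/
def BinTree (r : ℕ) : SimpleGraph (Fin (2 ^ (r + 1) - 1)) :=
  SimpleGraph.fromRel (fun a b =>
    b.val + 1 = 2 * (a.val + 1) ∨ b.val + 1 = 2 * (a.val + 1) + 1)

/-- The leaf-extension of `H` by leaves `L` attached via `f`. -/
def leafExt {W : Type} (H : SimpleGraph W) (L : Type) (f : L → W) :
    SimpleGraph (W ⊕ L) :=
  SimpleGraph.fromRel (fun a b =>
    match a, b with
    | Sum.inl a, Sum.inl b => H.Adj a b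
    | Sum.inl a, Sum.inr x => f x = a
    | _, _ => False)

/-- `G` has treewidth at most `k` (via tree decompositions). -/
def TreewidthLE {V : Type} (G : SimpleGraph V) (k : ℕ) : Prop :=
  ∃ (ι : Type) (T : SimpleGraph ι) (bag : ι → Set V),
    T.IsTree ∧
    (∀ v, ∃ i, v ∈ bag i) ∧
    (∀ u v, G.Adj u v → ∃ i, u ∈ bag i ∧ v ∈ bag i) ∧
    (∀ v, (T.induce {i | v ∈ bag i}).Connected) ∧
    (∀ i, (bag i).ncard ≤ k + 1)

/-- `G` has pathwidth at most `k` (via path decompositions). -/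
def PathwidthLE {V : Type} (G : SimpleGraph V) (k : ℕ) : Prop :=
  ∃ (n : ℕ) (bag : Fin n → Set V),
    (∀ v, ∃ i, v ∈ bag i) ∧
    (∀ u v, G.Adj u v → ∃ i, u ∈ bag i ∧ v ∈ bag i) ∧
    (∀ (v : V) (i j k' : Fin n), i ≤ j → j ≤ k' → v ∈ bag i → v ∈ bag k' → v ∈ bag j) ∧
    (∀ i, (bag i).ncard ≤ k + 1)

/-- An induced `(s,t)`-model in `G`. -/
def IsInducedModel {V : Type} (G : SimpleGraph V) {s t : ℕ}
    (A : Fin s → Set V) (B : Fin t → Set V) : Prop :=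
  (∀ i, (G.induce (A i)).Connected) ∧
  (∀ j, (G.induce (B j)).Connected) ∧
  (∀ i j : Fin s, i ≠ j → Anticomplete G (A i) (A j)) ∧
  (∀ i j : Fin t, i ≠ j → Anticomplete G (B i) (B j)) ∧
  (∀ (i : Fin s) (j : Fin t), Disjoint (A i) (B j) ∧ ¬ Anticomplete G (A i) (B j))

/-- The `A`-contraction of a model: each `A i` is contracted to the vertex `Sum.inl i`. -/
def AContraction {V : Type} (G : SimpleGraph V) {s t : ℕ}
    (A : Fin s → Set V) (B : Fin t → Set V) :
    SimpleGraph (Fin s ⊕ (⋃ j, B j : Set V)) :=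
  SimpleGraph.fromRel (fun x y =>
    match x, y with
    | Sum.inl i, Sum.inl i' => i ≠ i' ∧ ∃ a ∈ A i, ∃ a' ∈ A i', G.Adj a a'
    | Sum.inl i, Sum.inr b => ∃ a ∈ A i, G.Adj a ↑b
    | Sum.inr b, Sum.inr b' => G.Adj ↑b ↑b'
    | _, _ => False)

/-- A linear induced model is `d`-`A`-ample if its `A`-contraction is `d`-ample. -/
def ModelAAmple {V : Type} (G : SimpleGraph V) {s t : ℕ}
    (A : Fin s → Set V) (B : Fin t → Set V) (d : ℕ) : Prop :=
  DAmple (AContraction G A B) Set.univ (Set.range Sum.inl) d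

/-- A linear induced model is `d`-ample if it is `d`-`A`-ample and `d`-`B`-ample. -/
def ModelAmple {V : Type} (G : SimpleGraph V) {s t : ℕ}
    (A : Fin s → Set V) (B : Fin t → Set V) (d : ℕ) : Prop :=
  ModelAAmple G A B d ∧ ModelAAmple G B A d

/-- The zigzag sequences. -/
def Zseq : ℕ → List ℤ
  | 0 => []
  | 1 => [1]
  | 2 => [1, 2]
  | 3 => [1, 2, 3]
  | n + 4 =>
      (Zseq (n + 3)).dropLast ++ (((Zseq (n + 2)).map (· + 1)).reverse).dropLast
        ++ (Zseq (n + 3)).map (· + 1)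

/-- Collapse each maximal run of consecutive equal entries to a single entry. -/
def collapse (l : List ℤ) : List ℤ := l.destutter (· ≠ ·)

/-- `B` is an alignment in the sequence `A`. -/
def IsAlignment (A : List ℤ) (B : Finset ℤ) : Prop :=
  (∀ b ∈ B, b ∈ A) ∧
  ∃ i j : ℕ, i ≤ j ∧ j < A.length ∧
    ∀ b ∈ B,
      (collapse (((A.take (j + 1)).drop i).filter (fun a => decide (a ∈ B)))).count b = 1

/-- Finite Ramsey theorem for `k`-subsets of a linearly ordered set. -/
theorem exists_ramsey_bound (κ : Type) [Fintype κ] (k N : ℕ) :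
    ∃ n : ℕ, ∀ (α : Type) [LinearOrder α] (S : Finset α) (P : κ → Finset α → Prop),
      n ≤ S.card → (∀ T ⊆ S, T.card = k → ∃ c, P c T) →
        ∃ c, ∃ S' ⊆ S, S'.card = N ∧ ∀ T ⊆ S', T.card = k → P c T := by
  classical
  induction k generalizing N with
  | zero =>
    refine ⟨N, fun α _ S P hS hP => ?_⟩
    obtain ⟨S', hS', hc⟩ := Finset.exists_subset_card_eq hS
    obtain ⟨c, h⟩ := hP ∅ (by simp) rfl
    refine ⟨c, S', hS', hc, fun T _ hT => ?_⟩
    rwa [Finset.card_eq_zero.mp hT]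
  | succ k ih =>
    have endHomogeneous : ∀ q : ℕ, ∃ n : ℕ, ∀ (α : Type) [LinearOrder α] (S : Finset α)
        (P : κ → Finset α → Prop), n ≤ S.card → (∀ T ⊆ S, T.card = k + 1 → ∃ c, P c T) →
        ∃ A ⊆ S, A.card = q ∧ ∀ x ∈ A, ∃ c, ∀ T ⊆ A, T.card = k → (∀ y ∈ T, x < y) →
          P c (insert x T) := by
      intro q
      induction q with
      | zero => exact ⟨0, fun α _ S P _ _ => ⟨∅, by simp, rfl, by simp⟩⟩
      | succ q ihq =>
        obtain ⟨n₁, h₁⟩ := ihq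
        obtain ⟨n₂, h₂⟩ := ih n₁
        refine ⟨n₂ + 1, fun α _ S P hS hP => ?_⟩
        have hne : S.Nonempty := Finset.card_pos.mp (by omega)
        set x := S.min' hne
        have hxS : x ∈ S := S.min'_mem hne
        have hx : ∀ y ∈ S.erase x, x < y := fun y hy => S.min'_lt_of_mem_erase_min' hne hy
        obtain ⟨c, S₁, hS₁, hc₁, hcol⟩ := h₂ α (S.erase x) (fun c T => P c (insert x T))
          (by rw [Finset.card_erase_of_mem hxS]; omega)
          (fun T hT hTc => hP _ (Finset.insert_subset hxS (hT.trans (Finset.erase_subset _ _)))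
            (by rw [Finset.card_insert_of_notMem (fun h => (hx x (hT h)).false), hTc]))
        have hS₁S : S₁ ⊆ S := hS₁.trans (Finset.erase_subset _ _)
        obtain ⟨A, hA, hAc, hAcol⟩ := h₁ α S₁ P hc₁.ge (fun T hT => hP T (hT.trans hS₁S))
        have hxA : x ∉ A := fun h => (hx x (hS₁ (hA h))).false
        refine ⟨insert x A, Finset.insert_subset hxS (hA.trans hS₁S), by
          rw [Finset.card_insert_of_notMem hxA, hAc], fun y hy => ?_⟩
        have key : ∀ T ⊆ insert x A, (∀ z ∈ T, y < z) → T ⊆ A := by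
          intro T hT hyT z hz
          rcases Finset.mem_insert.mp (hT hz) with rfl | h
          · rcases Finset.mem_insert.mp hy with rfl | h'
            · exact absurd (hyT _ hz) (lt_irrefl _)
            · exact absurd (hyT _ hz) (hx y (hS₁ (hA h'))).not_gt
          · exact h
        rcases Finset.mem_insert.mp hy with rfl | hyA
        · exact ⟨c, fun T hT hTc hyT => hcol T ((key T hT hyT).trans hA) hTc⟩
        · obtain ⟨c', hc'⟩ := hAcol y hyA
          exact ⟨c', fun T hT hTc hyT => hc' T (key T hT hyT) hTc hyT⟩
    obtain ⟨n, hn⟩ := endHomogeneous (Fintype.card κ * N + 1)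
    refine ⟨n, fun α _ S P hS hP => ?_⟩
    obtain ⟨A, hAS, hAc, hA⟩ := hn α S P hS hP
    obtain ⟨x, hx⟩ : A.Nonempty := Finset.card_pos.mp (by omega)
    have : Nonempty κ := ⟨(hA x hx).choose⟩
    choose! col hcol using hA
    obtain ⟨c, -, hc⟩ := Finset.exists_le_card_fiber_of_mul_le_card_of_maps_to
      (s := A) (t := Finset.univ) (f := col) (n := N) (fun _ _ => Finset.mem_univ _)
      Finset.univ_nonempty (by rw [Finset.card_univ]; omega)
    obtain ⟨S', hS', hS'c⟩ := Finset.exists_subset_card_eq hc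
    have hS'A : S' ⊆ A := hS'.trans (Finset.filter_subset _ _)
    refine ⟨c, S', hS'A.trans hAS, hS'c, fun T hT hTc => ?_⟩
    have hne : T.Nonempty := Finset.card_pos.mp (by omega)
    have hm := T.min'_mem hne
    have := hcol _ (hS'A (hT hm)) (T.erase (T.min' hne))
      ((Finset.erase_subset _ _).trans (hT.trans hS'A))
      (by rw [Finset.card_erase_of_mem hm]; omega)
      (fun y hy => T.min'_lt_of_mem_erase_min' hne hy)
    rwa [Finset.insert_erase hm, (Finset.mem_filter.mp (hS' (hT hm))).2] at this

/-- Inside a large enough ordered set one finds `N` elements with at least `D` elements of the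
set before, after, and between any two of them. -/
theorem exists_sparse_subset {α : Type} [LinearOrder α] (S : Finset α) (N D : ℕ)
    (hS : (N + 1) * (D + 1) ≤ S.card) :
    ∃ T ⊆ S, T.card = N ∧
      (∀ x ∈ T, D ≤ (S.filter (· < x)).card) ∧
      (∀ x ∈ T, D ≤ (S.filter (x < ·)).card) ∧
      ∀ x ∈ T, ∀ y ∈ T, x < y → D ≤ (S.filter fun z => x < z ∧ z < y).card := by
  classical
  have hsc : (N + 1) * (D + 1) = N * (D + 1) + (D + 1) := by ring
  let e := S.orderEmbOfFin rfl
  have hpos : ∀ k : Fin N, k * (D + 1) + D < S.card := fun k => by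
    have : (k + 1) * (D + 1) ≤ N * (D + 1) := Nat.mul_le_mul_right _ k.2
    have h2 : ((k : ℕ) + 1) * (D + 1) = k * (D + 1) + (D + 1) := by ring
    omega
  let g : Fin N → α := fun k => e ⟨k * (D + 1) + D, hpos k⟩
  have hmono : StrictMono g := by
    intro k k' hk
    have : (k + 1) * (D + 1) ≤ (k' : ℕ) * (D + 1) := Nat.mul_le_mul_right _ hk
    have h2 : ((k : ℕ) + 1) * (D + 1) = k * (D + 1) + (D + 1) := by ring
    exact e.strictMono (Fin.mk_lt_mk.mpr (by omega))
  have count : ∀ (p : α → Prop) [DecidablePred p] (u : ℕ) (hu : u + D ≤ S.card),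
      (∀ i : Fin S.card, u ≤ i → (i : ℕ) < u + D → p (e i)) → D ≤ (S.filter p).card := by
    intro p _ u hu hp
    have : (Finset.univ : Finset (Fin D)).card ≤ (S.filter p).card := by
      refine Finset.card_le_card_of_injOn (fun i => e ⟨u + i, by omega⟩) (fun i _ => ?_) ?_
      · simp only [Finset.coe_filter, Set.mem_ofPred_eq]
        exact ⟨S.orderEmbOfFin_mem rfl _, hp _ (by simp) (by simp)⟩
      · intro i _ j _ hij
        have := e.injective hij
        simp only [Fin.mk.injEq] at this
        exact Fin.ext (by omega)
    simpa using this
  refine ⟨Finset.univ.image g, ?_, ?_, ?_, ?_, ?_⟩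
  · intro x hx
    obtain ⟨k, -, rfl⟩ := Finset.mem_image.mp hx
    exact S.orderEmbOfFin_mem rfl _
  · rw [Finset.card_image_of_injective _ hmono.injective]; simp
  · intro x hx
    obtain ⟨k, -, rfl⟩ := Finset.mem_image.mp hx
    refine count _ 0 (by omega) fun i _ hi => e.strictMono (Fin.lt_def.mpr ?_)
    simp only; omega
  · intro x hx
    obtain ⟨k, -, rfl⟩ := Finset.mem_image.mp hx
    have h1 : (k + 1) * (D + 1) ≤ N * (D + 1) := Nat.mul_le_mul_right _ k.2
    have h2 : ((k : ℕ) + 1) * (D + 1) = k * (D + 1) + (D + 1) := by ring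
    refine count _ (k * (D + 1) + D + 1) (by omega)
      fun i hi _ => e.strictMono (Fin.lt_def.mpr ?_)
    simp only; omega
  · intro x hx y hy hxy
    obtain ⟨k, -, rfl⟩ := Finset.mem_image.mp hx
    obtain ⟨k', -, rfl⟩ := Finset.mem_image.mp hy
    have hk : (k : ℕ) + 1 ≤ k' := hmono.lt_iff_lt.mp hxy
    have h0 : (k + 1) * (D + 1) ≤ (k' : ℕ) * (D + 1) := Nat.mul_le_mul_right _ hk
    have h2 : ((k : ℕ) + 1) * (D + 1) = k * (D + 1) + (D + 1) := by ring
    have h3 := hpos k'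
    refine count _ (k * (D + 1) + D + 1) (by omega) fun i hi hi' =>
      ⟨e.strictMono (Fin.lt_def.mpr ?_), e.strictMono (Fin.lt_def.mpr ?_)⟩
    · simp only; omega
    · simp only; omega

/-- If `R` can be achieved for one index by passing to a subset, then it can be achieved for
`K` indices at once by passing to subsets repeatedly. -/
theorem exists_subset_forall_of_step {ι α : Type} (Q R : ι → Finset α → Prop)
    (hQ : ∀ i S S', S' ⊆ S → Q i S → Q i S') (hR : ∀ i S S', S' ⊆ S → R i S → R i S')
    (F : ℕ → ℕ)
    (step : ∀ N i S, F N ≤ S.card → Q i S → ∃ S' ⊆ S, S'.card = N ∧ R i S')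
    (K N : ℕ) (I : Finset ι) (hI : I.card = K) (S : Finset α)
    (hS : F^[K] N ≤ S.card) (hQS : ∀ i ∈ I, Q i S) :
    ∃ S' ⊆ S, S'.card = N ∧ ∀ i ∈ I, R i S' := by
  classical
  induction K generalizing I S with
  | zero =>
    obtain ⟨S', hS', hc⟩ := Finset.exists_subset_card_eq hS
    refine ⟨S', hS', hc, ?_⟩
    simp [Finset.card_eq_zero.mp hI]
  | succ K ih =>
    obtain ⟨i, I', hi, rfl, hI'⟩ := Finset.card_eq_succ.mp hI
    rw [Function.iterate_succ_apply'] at hS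
    obtain ⟨S₁, hS₁, hc₁, hR₁⟩ := step _ i S hS (hQS i (Finset.mem_insert_self _ _))
    obtain ⟨S', hS', hc', hR'⟩ := ih I' hI' S₁ hc₁.ge
      fun j hj => hQ _ _ _ hS₁ (hQS j (Finset.mem_insert_of_mem hj))
    refine ⟨S', hS'.trans hS₁, hc', fun j hj => ?_⟩
    rcases Finset.mem_insert.mp hj with rfl | hj
    · exact hR _ _ _ hS' hR₁
    · exact hR' j hj

/-- Some letter of the positions `i, …, j` of the word `h` is `x`; here `h k x` says that the
`k`-th position of the word carries the letter `x`, possibly along with others. -/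
def Meets {α : Type} (h : ℕ → α → Prop) (i j : ℕ) (x : α) : Prop :=
  ∃ k, i ≤ k ∧ k ≤ j ∧ h k x

theorem Meets.mono {α : Type} {h : ℕ → α → Prop} {i j i' j' : ℕ} {x : α}
    (hx : Meets h i' j' x) (hi : i ≤ i') (hj : j' ≤ j) : Meets h i j x := by
  obtain ⟨k, h1, h2, h3⟩ := hx
  exact ⟨k, by omega, by omega, h3⟩

open scoped Classical in
/-- Every subinterval of `[i, j]` that meets letters `x < y` of `S` misses fewer than `a` letters
of `S` below `x`, or fewer than `b` between, or fewer than `c` above `y`. -/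
def WordMixed {α : Type} [LinearOrder α] (h : ℕ → α → Prop) (i j : ℕ) (S : Finset α)
    (a b c : ℕ) : Prop :=
  ∀ x ∈ S, ∀ y ∈ S, x < y → ∀ i' j', i ≤ i' → j' ≤ j → Meets h i' j' x → Meets h i' j' y →
    (S.filter fun z => z < x ∧ ¬ Meets h i' j' z).card < a ∨
    (S.filter fun z => x < z ∧ z < y ∧ ¬ Meets h i' j' z).card < b ∨
    (S.filter fun z => y < z ∧ ¬ Meets h i' j' z).card < c

/-- Every subinterval of `[i, j]` that meets letters `x < y` of `S` meets all higher ones. -/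
def WordUp {α : Type} [LinearOrder α] (h : ℕ → α → Prop) (i j : ℕ) (S : Finset α) : Prop :=
  ∀ x ∈ S, ∀ y ∈ S, ∀ z ∈ S, x < y → y < z → ∀ i' j', i ≤ i' → j' ≤ j →
    Meets h i' j' x → Meets h i' j' y → Meets h i' j' z

/-- Every subinterval of `[i, j]` that meets letters `x < y` of `S` meets all lower ones. -/
def WordDown {α : Type} [LinearOrder α] (h : ℕ → α → Prop) (i j : ℕ) (S : Finset α) : Prop :=
  ∀ x ∈ S, ∀ y ∈ S, ∀ z ∈ S, x < y → z < x → ∀ i' j', i ≤ i' → j' ≤ j →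
    Meets h i' j' x → Meets h i' j' y → Meets h i' j' z

/-- Subintervals of `[i, j]` with at most `d` positions meet at most one letter of `S`. -/
def WordAmple {α : Type} (h : ℕ → α → Prop) (i j : ℕ) (S : Finset α) (d : ℕ) : Prop :=
  ∀ x ∈ S, ∀ y ∈ S, x ≠ y → ∀ i' j', i ≤ i' → j' ≤ j →
    Meets h i' j' x → Meets h i' j' y → d + i' ≤ j'

theorem WordMixed.mono {α : Type} [LinearOrder α] {h : ℕ → α → Prop} {i j i' j' : ℕ}
    {S S' : Finset α} {a b c : ℕ} (hm : WordMixed h i j S a b c) (hS : S' ⊆ S) (hi : i ≤ i')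
    (hj : j' ≤ j) : WordMixed h i' j' S' a b c := by
  classical
  intro x hx y hy hxy k l hk hl hkx hky
  rcases hm x (hS hx) y (hS hy) hxy k l (hi.trans hk) (hl.trans hj) hkx hky with H | H | H
  · exact Or.inl ((Finset.card_le_card (Finset.filter_subset_filter _ hS)).trans_lt H)
  · exact Or.inr (Or.inl ((Finset.card_le_card (Finset.filter_subset_filter _ hS)).trans_lt H))
  · exact Or.inr (Or.inr ((Finset.card_le_card (Finset.filter_subset_filter _ hS)).trans_lt H))

theorem WordUp.mono {α : Type} [LinearOrder α] {h : ℕ → α → Prop} {i j : ℕ}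
    {S S' : Finset α} (hm : WordUp h i j S) (hS : S' ⊆ S) : WordUp h i j S' :=
  fun x hx y hy z hz => hm x (hS hx) y (hS hy) z (hS hz)

theorem WordDown.mono {α : Type} [LinearOrder α] {h : ℕ → α → Prop} {i j : ℕ}
    {S S' : Finset α} (hm : WordDown h i j S) (hS : S' ⊆ S) : WordDown h i j S' :=
  fun x hx y hy z hz => hm x (hS hx) y (hS hy) z (hS hz)

theorem WordAmple.mono {α : Type} {h : ℕ → α → Prop} {i j i' j' : ℕ} {S S' : Finset α} {d : ℕ}
    (hm : WordAmple h i j S d) (hS : S' ⊆ S) (hi : i ≤ i') (hj : j' ≤ j) :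
    WordAmple h i' j' S' d :=
  fun x hx y hy hxy k l hk hl => hm x (hS hx) y (hS hy) hxy k l (hi.trans hk) (hl.trans hj)

theorem card_filter_le_of_missed {α : Type} {S : Finset α} {p q : α → Prop}
    [DecidablePred p] [DecidablePred q] :
    (S.filter p).card ≤ (S.filter fun z => p z ∧ q z).card +
      (S.filter fun z => p z ∧ ¬ q z).card := by
  classical
  rw [← Finset.card_filter_add_card_filter_not (s := S.filter p) q, Finset.filter_filter,
    Finset.filter_filter]

theorem wordMixed_toDual {α : Type} [LinearOrder α] {h : ℕ → α → Prop} {i j : ℕ}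
    {S : Finset α} {a b c : ℕ} (hm : WordMixed h i j S a b c) :
    WordMixed (α := αᵒᵈ) h i j S c b a := by
  classical
  have key : ∀ (x y : α) (k l : ℕ), (S.filter fun z => x < z ∧ z < y ∧ ¬ Meets h k l z).card =
      (S.filter fun z => z < y ∧ x < z ∧ ¬ Meets h k l z).card := fun x y k l =>
    congrArg Finset.card (Finset.filter_congr fun z _ => by tauto)
  intro x hx y hy hxy k l hk hl hkx hky
  rcases hm y hy x hx hxy k l hk hl hky hkx with H | H | H
  · exact Or.inr (Or.inr H)
  · exact Or.inr (Or.inl ((key y x k l).symm.trans_lt H))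
  · exact Or.inl H

/-- A mixed word can be cut down to one that is `WordDown` or is mixed without restrictions on
the letters below. -/
theorem exists_wordDown_or_wordMixed (a b c N : ℕ) :
    ∃ n : ℕ, ∀ (α : Type) [LinearOrder α] (h : ℕ → α → Prop) (i j : ℕ) (S : Finset α),
      n ≤ S.card → (∀ x ∈ S, Meets h i j x) → WordMixed h i j S a b c →
      ∃ S' ⊆ S, S'.card = N ∧ ∃ lo hi, i ≤ lo ∧ hi ≤ j ∧ (∀ x ∈ S', Meets h lo hi x) ∧
        (WordDown h lo hi S' ∨ WordMixed h lo hi S' 0 b c) := by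
  classical
  induction a with
  | zero =>
    refine ⟨N, fun α _ h i j S hS hmeet hm => ?_⟩
    obtain ⟨S', hS', hc⟩ := Finset.exists_subset_card_eq hS
    exact ⟨S', hS', hc, i, j, le_rfl, le_rfl, fun x hx => hmeet x (hS' hx),
      Or.inr (hm.mono hS' le_rfl le_rfl)⟩
  | succ a ih =>
    obtain ⟨n, hn⟩ := ih
    refine ⟨(N + 1) * (n + a + b + c + 1 + 1), fun α _ h i j S hS hmeet hm => ?_⟩
    by_cases hcase : ∃ z ∈ S, ∃ i' j', i ≤ i' ∧ j' ≤ j ∧ ¬ Meets h i' j' z ∧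
        n ≤ (S.filter fun s => z < s ∧ Meets h i' j' s).card
    · obtain ⟨z, hz, i', j', hi, hj, hzm, hcard⟩ := hcase
      have hsub : (S.filter fun s => z < s ∧ Meets h i' j' s) ⊆ S := Finset.filter_subset _ _
      obtain ⟨S', hS', hc, lo, hi', h1, h2, h3, h4⟩ := hn α h i' j' _ hcard
        (fun x hx => (Finset.mem_filter.mp hx).2.2) (by
          intro x hx y hy hxy k l hk hl hkx hky
          have hx' := Finset.mem_filter.mp hx
          rcases hm x (hsub hx) y (hsub hy) hxy k l (hi.trans hk) (hl.trans hj) hkx hky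
            with H | H | H
          · left
            have hsub' : insert z ((S.filter fun s => z < s ∧ Meets h i' j' s).filter
                fun z => z < x ∧ ¬ Meets h k l z) ⊆ S.filter fun z => z < x ∧ ¬ Meets h k l z :=
              Finset.insert_subset
                (Finset.mem_filter.mpr ⟨hz, hx'.2.1, fun hh => hzm (hh.mono hk hl)⟩)
                (Finset.filter_subset_filter _ hsub)
            have := Finset.card_le_card hsub'
            rw [Finset.card_insert_of_notMem (by simp)] at this
            omega
          · exact Or.inr (Or.inl
              ((Finset.card_le_card (Finset.filter_subset_filter _ hsub)).trans_lt H))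
          · exact Or.inr (Or.inr
              ((Finset.card_le_card (Finset.filter_subset_filter _ hsub)).trans_lt H)))
      exact ⟨S', hS'.trans hsub, hc, lo, hi', hi.trans h1, h2.trans hj, h3, h4⟩
    · push Not at hcase
      obtain ⟨T, hTS, hTc, -, hTabove, hTbetween⟩ := exists_sparse_subset S N _ hS
      refine ⟨T, hTS, hTc, i, j, le_rfl, le_rfl, fun x hx => hmeet x (hTS hx), Or.inl ?_⟩
      intro x hx y hy z hz hxy hzx k l hk hl hkx hky
      by_contra hkz
      have few := hcase z (hTS hz) k l hk hl hkz
      have bound : ∀ (p : α → Prop) [DecidablePred p], (∀ s, p s → z < s) →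
          n + a + b + c + 1 ≤ (S.filter p).card →
          a + b + c + 1 < (S.filter fun s => p s ∧ ¬ Meets h k l s).card + 1 := by
        intro p _ hp hc
        have h1 := card_filter_le_of_missed (S := S) (p := p) (q := fun s => Meets h k l s)
        have h2 : (S.filter fun s => p s ∧ Meets h k l s).card ≤
            (S.filter fun s => z < s ∧ Meets h k l s).card :=
          Finset.card_le_card (Finset.monotone_filter_right _ fun s _ hs => ⟨hp s hs.1, hs.2⟩)
        omega
      rcases hm x (hTS hx) y (hTS hy) hxy k l hk hl hkx hky with H | H | H
      · have h1 := bound (fun s => z < s ∧ s < x) (fun s hs => hs.1) (hTbetween z hz x hx hzx)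
        have h2 : (S.filter fun s => (z < s ∧ s < x) ∧ ¬ Meets h k l s).card ≤
            (S.filter fun s => s < x ∧ ¬ Meets h k l s).card :=
          Finset.card_le_card (Finset.monotone_filter_right _ fun s _ hs => ⟨hs.1.2, hs.2⟩)
        omega
      · have h1 := bound (fun s => x < s ∧ s < y) (fun s hs => hzx.trans hs.1)
          (hTbetween x hx y hy hxy)
        simp only [and_assoc] at h1
        omega
      · have h1 := bound (fun s => y < s) (fun s hs => (hzx.trans hxy).trans hs)
          (hTabove y hy)
        omega

/-- A mixed word can be cut down to one that is `WordUp` or is mixed without restrictions on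
the letters above. -/
theorem exists_wordUp_or_wordMixed (a b c N : ℕ) :
    ∃ n : ℕ, ∀ (α : Type) [LinearOrder α] (h : ℕ → α → Prop) (i j : ℕ) (S : Finset α),
      n ≤ S.card → (∀ x ∈ S, Meets h i j x) → WordMixed h i j S a b c →
      ∃ S' ⊆ S, S'.card = N ∧ ∃ lo hi, i ≤ lo ∧ hi ≤ j ∧ (∀ x ∈ S', Meets h lo hi x) ∧
        (WordUp h lo hi S' ∨ WordMixed h lo hi S' a b 0) := by
  obtain ⟨n, hn⟩ := exists_wordDown_or_wordMixed c b a N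
  refine ⟨n, fun α _ h i j S hS hmeet hm => ?_⟩
  obtain ⟨S', hS', hc, lo, hi, h1, h2, h3, h4⟩ := hn αᵒᵈ h i j S hS hmeet (wordMixed_toDual hm)
  refine ⟨S', hS', hc, lo, hi, h1, h2, h3, ?_⟩
  rcases h4 with h4 | h4
  · exact Or.inl fun x hx y hy z hz hxy hyz k l hk hl hkx hky =>
      h4 y hy x hx z hz hxy hyz k l hk hl hky hkx
  · exact Or.inr (wordMixed_toDual (α := αᵒᵈ) h4)

/-- A mixed word without crowded positions can be cut down to an ample one. -/
theorem exists_wordAmple_subset {α : Type} [LinearOrder α] {h : ℕ → α → Prop} {i j : ℕ}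
    {S : Finset α} {q d r N : ℕ} (hm : WordMixed h i j S q q q)
    (hr : ∀ k, i ≤ k → k ≤ j → ∀ R ⊆ S, (∀ x ∈ R, h k x) → R.card ≤ r)
    (hS : (N + 1) * (d * r + q + 1) ≤ S.card) :
    ∃ T ⊆ S, T.card = N ∧ WordAmple h i j T d := by
  classical
  obtain ⟨T, hTS, hTc, hbelow, habove, hbetween⟩ := exists_sparse_subset S N _ hS
  have key : ∀ x ∈ T, ∀ y ∈ T, x < y → ∀ i' j', i ≤ i' → j' ≤ j →
      Meets h i' j' x → Meets h i' j' y → d + i' ≤ j' := by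
    intro x hx y hy hxy k l hk hl hkx hky
    by_contra hlt
    have few : (S.filter fun s => Meets h k l s).card ≤ d * r := by
      have hsub : (S.filter fun s => Meets h k l s) ⊆
          (Finset.Icc k l).biUnion fun m => S.filter fun s => h m s := by
        intro s hs
        obtain ⟨hsS, m, h1, h2, h3⟩ := Finset.mem_filter.mp hs
        exact Finset.mem_biUnion.mpr
          ⟨m, Finset.mem_Icc.mpr ⟨h1, h2⟩, Finset.mem_filter.mpr ⟨hsS, h3⟩⟩
      refine (Finset.card_le_card hsub).trans ((Finset.card_biUnion_le_card_mul _ _ r ?_).trans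
        (Nat.mul_le_mul_right _ (by rw [Nat.card_Icc]; omega)))
      intro m hm'
      have := Finset.mem_Icc.mp hm'
      exact hr m (hk.trans this.1) (this.2.trans hl) _ (Finset.filter_subset _ _)
        fun x hx => (Finset.mem_filter.mp hx).2
    have bound : ∀ (p : α → Prop) [DecidablePred p],
        d * r + q ≤ (S.filter p).card →
        q ≤ (S.filter fun s => p s ∧ ¬ Meets h k l s).card := by
      intro p _ hc
      have h1 := card_filter_le_of_missed (S := S) (p := p) (q := fun s => Meets h k l s)
      have h2 : (S.filter fun s => p s ∧ Meets h k l s).card ≤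
          (S.filter fun s => Meets h k l s).card :=
        Finset.card_le_card (Finset.monotone_filter_right _ fun s _ hs => hs.2)
      omega
    rcases hm x (hTS hx) y (hTS hy) hxy k l hk hl hkx hky with H | H | H
    · exact absurd H (bound _ (hbelow x hx)).not_gt
    · have := bound _ (hbetween x hx y hy hxy)
      simp only [and_assoc] at this
      omega
    · exact absurd H (bound _ (habove y hy)).not_gt
  refine ⟨T, hTS, hTc, fun x hx y hy hxy k l hk hl hkx hky => ?_⟩
  rcases lt_or_gt_of_ne hxy with hlt | hlt
  · exact key x hx y hy hlt k l hk hl hkx hky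
  · exact key y hy x hx hlt k l hk hl hky hkx

/-- The three outcomes for a word. -/
def WordKind {α : Type} [LinearOrder α] (κ : Fin 3) (q : ℕ) (h : ℕ → α → Prop) (i j : ℕ)
    (S : Finset α) : Prop :=
  (κ = 0 ∧ WordUp h i j S) ∨ (κ = 1 ∧ WordDown h i j S) ∨ (κ = 2 ∧ WordMixed h i j S 0 q 0)

/-- Some subinterval of `[i, j]` is ample, meets all of `S`, and is of kind `κ`. -/
def WordReducible {α : Type} [LinearOrder α] (κ : Fin 3) (d q : ℕ) (h : ℕ → α → Prop)
    (i j : ℕ) (S : Finset α) : Prop :=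
  ∃ lo hi, i ≤ lo ∧ hi ≤ j ∧ (∀ x ∈ S, Meets h lo hi x) ∧ WordAmple h lo hi S d ∧
    WordKind κ q h lo hi S

theorem WordReducible.mono {α : Type} [LinearOrder α] {κ : Fin 3} {d q : ℕ} {h : ℕ → α → Prop}
    {i j : ℕ} {S S' : Finset α} (hS : S' ⊆ S) (hr : WordReducible κ d q h i j S) :
    WordReducible κ d q h i j S' := by
  obtain ⟨lo, hi, h1, h2, h3, h4, h5⟩ := hr
  refine ⟨lo, hi, h1, h2, fun x hx => h3 x (hS hx), h4.mono hS le_rfl le_rfl, ?_⟩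
  rcases h5 with h5 | h5 | h5
  · exact Or.inl ⟨h5.1, h5.2.mono hS⟩
  · exact Or.inr (Or.inl ⟨h5.1, h5.2.mono hS⟩)
  · exact Or.inr (Or.inr ⟨h5.1, h5.2.mono hS le_rfl le_rfl⟩)

theorem exists_wordReducible (q d r N : ℕ) :
    ∃ n : ℕ, ∀ (α : Type) [LinearOrder α] (h : ℕ → α → Prop) (i j : ℕ) (S : Finset α),
      n ≤ S.card → (∀ x ∈ S, Meets h i j x) → WordMixed h i j S q q q →
      (∀ k, i ≤ k → k ≤ j → ∀ R ⊆ S, (∀ x ∈ R, h k x) → R.card ≤ r) →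
      ∃ S' ⊆ S, S'.card = N ∧ ∃ κ, WordReducible κ d q h i j S' := by
  obtain ⟨n₁, h₁⟩ := exists_wordUp_or_wordMixed 0 q q N
  obtain ⟨n₂, h₂⟩ := exists_wordDown_or_wordMixed q q q (n₁ + N)
  refine ⟨(n₂ + 1) * (d * r + q + 1), fun α _ h i j S hS hmeet hm hr => ?_⟩
  obtain ⟨S₁, hS₁, hc₁, ham⟩ := exists_wordAmple_subset hm hr hS
  obtain ⟨S₂, hS₂, hc₂, lo, hi, hlo, hhi, hmeet₂, H⟩ := h₂ α h i j S₁ hc₁.ge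
    (fun x hx => hmeet x (hS₁ hx)) (hm.mono hS₁ le_rfl le_rfl)
  rcases H with H | H
  · obtain ⟨S₃, hS₃, hc₃⟩ := Finset.exists_subset_card_eq (show N ≤ S₂.card by omega)
    exact ⟨S₃, (hS₃.trans hS₂).trans hS₁, hc₃, 1, lo, hi, hlo, hhi,
      fun x hx => hmeet₂ x (hS₃ hx), ham.mono (hS₃.trans hS₂) hlo hhi,
      Or.inr (Or.inl ⟨rfl, H.mono hS₃⟩)⟩
  · obtain ⟨S₃, hS₃, hc₃, lo', hi', hlo', hhi', hmeet₃, H⟩ := h₁ α h lo hi S₂ (by omega)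
      hmeet₂ H
    refine ⟨S₃, (hS₃.trans hS₂).trans hS₁, hc₃, ?_⟩
    have ham' := ham.mono (hS₃.trans hS₂) (hlo.trans hlo') (hhi'.trans hhi)
    rcases H with H | H
    · exact ⟨0, lo', hi', hlo.trans hlo', hhi'.trans hhi, hmeet₃, ham', Or.inl ⟨rfl, H⟩⟩
    · exact ⟨2, lo', hi', hlo.trans hlo', hhi'.trans hhi, hmeet₃, ham',
        Or.inr (Or.inr ⟨rfl, H⟩)⟩

/-- Any two letters of `T` are met by an interval that misses all other letters of `T`. -/
def WordFull {α : Type} (h : ℕ → α → Prop) (i j : ℕ) (T : Finset α) : Prop :=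
  ∀ x ∈ T, ∀ y ∈ T, x ≠ y → ∃ i' j', i ≤ i' ∧ j' ≤ j ∧ Meets h i' j' x ∧ Meets h i' j' y ∧
    ∀ z ∈ T, z ≠ x → z ≠ y → ¬ Meets h i' j' z

theorem exists_wordFull_or_wordMixed (q N : ℕ) :
    ∃ n : ℕ, ∀ (α : Type) [LinearOrder α] (h : ℕ → α → Prop) (i j : ℕ) (S : Finset α),
      n ≤ S.card → ∃ S' ⊆ S, S'.card = N ∧
        ((∀ T ⊆ S', T.card = q + 2 → WordFull h i j T) ∨ WordMixed h i j S' q q q) := by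
  classical
  obtain ⟨n, hn⟩ := exists_ramsey_bound (Option (Fin (q + 1) × Fin (q + 1) × Fin (q + 1)))
    (q + 2) (N + (q + 2))
  refine ⟨n, fun α _ h i j S hS => ?_⟩
  let P : Option (Fin (q + 1) × Fin (q + 1) × Fin (q + 1)) → Finset α → Prop := fun c T =>
    match c with
    | none => WordFull h i j T
    | some (a, b, c) => ∃ x ∈ T, ∃ y ∈ T, x < y ∧ (T.filter (· < x)).card = a ∧
        (T.filter fun z => x < z ∧ z < y).card = b ∧ (T.filter (y < ·)).card = c ∧
        ∀ i' j', i ≤ i' → j' ≤ j → Meets h i' j' x → Meets h i' j' y →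
          ∃ z ∈ T, z ≠ x ∧ z ≠ y ∧ Meets h i' j' z
  have hsplit : ∀ (T : Finset α) (x y : α), x ∈ T → y ∈ T → x < y →
      T.card = (T.filter (· < x)).card + (T.filter fun z => x < z ∧ z < y).card +
        (T.filter (y < ·)).card + 2 := by
    intro T x y hx hy hxy
    have : T = insert x (insert y (T.filter (· < x) ∪ (T.filter fun z => x < z ∧ z < y) ∪
        T.filter (y < ·))) := by
      ext z
      simp only [Finset.mem_insert, Finset.mem_union, Finset.mem_filter]
      constructor
      · intro hz
        rcases lt_trichotomy z x with h1 | h1 | h1 <;> rcases lt_trichotomy z y with h2 | h2 | h2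
        all_goals tauto
      · rintro (rfl | rfl | h) <;> tauto
    conv_lhs => rw [this]
    rw [Finset.card_insert_of_notMem, Finset.card_insert_of_notMem, Finset.card_union_of_disjoint,
      Finset.card_union_of_disjoint]
    · rw [Finset.disjoint_left]
      intro z h1 h2
      simp only [Finset.mem_filter] at h1 h2
      exact absurd h1.2 h2.2.1.not_gt
    · rw [Finset.disjoint_left]
      intro z h1 h2
      simp only [Finset.mem_filter, Finset.mem_union] at h1 h2
      rcases h1 with h1 | h1
      · exact absurd h2.2 (h1.2.trans hxy).not_gt
      · exact absurd h2.2 h1.2.2.not_gt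
    · simp [hxy.not_gt]
    · simp [hxy.ne, hxy.not_gt]
  obtain ⟨c, S', hS', hc, hcol⟩ := hn α S P hS (by
    intro T hT hTc
    by_cases hf : WordFull h i j T
    · exact ⟨none, hf⟩
    · have : ∃ x ∈ T, ∃ y ∈ T, x < y ∧ ∀ i' j', i ≤ i' → j' ≤ j → Meets h i' j' x →
          Meets h i' j' y → ∃ z ∈ T, z ≠ x ∧ z ≠ y ∧ Meets h i' j' z := by
        unfold WordFull at hf
        push Not at hf
        obtain ⟨x, hx, y, hy, hxy, H⟩ := hf
        rcases lt_or_gt_of_ne hxy with hlt | hlt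
        · exact ⟨x, hx, y, hy, hlt, H⟩
        · refine ⟨y, hy, x, hx, hlt, fun i' j' h1 h2 h3 h4 => ?_⟩
          obtain ⟨z, hz, h5, h6, h7⟩ := H i' j' h1 h2 h4 h3
          exact ⟨z, hz, h6, h5, h7⟩
      obtain ⟨x, hx, y, hy, hxy, H⟩ := this
      have := hsplit T x y hx hy hxy
      exact ⟨some (⟨(T.filter (· < x)).card, by omega⟩,
        ⟨(T.filter fun z => x < z ∧ z < y).card, by omega⟩, ⟨(T.filter (y < ·)).card, by omega⟩),
        x, hx, y, hy, hxy, rfl, rfl, rfl, H⟩)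
  obtain ⟨S₀, hS₀, hc₀⟩ := Finset.exists_subset_card_eq (show N ≤ S'.card by omega)
  refine ⟨S₀, hS₀.trans hS', hc₀, ?_⟩
  match c, hcol with
  | none, hcol => exact Or.inl fun T hT hTc => hcol T (hT.trans hS₀) hTc
  | some (a, b, c), hcol =>
    right
    have habc : (a : ℕ) + b + c = q := by
      obtain ⟨T, hT, hTc⟩ := Finset.exists_subset_card_eq (show q + 2 ≤ S'.card by omega)
      obtain ⟨x, hx, y, hy, hxy, h1, h2, h3, -⟩ := hcol T hT hTc
      have := hsplit T x y hx hy hxy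
      omega
    intro x hx y hy hxy k l hk hl hkx hky
    by_contra hcon
    push Not at hcon
    obtain ⟨A, hA, hAc⟩ := Finset.exists_subset_card_eq
      ((show (a : ℕ) ≤ q by omega).trans hcon.1)
    obtain ⟨B, hB, hBc⟩ := Finset.exists_subset_card_eq
      ((show (b : ℕ) ≤ q by omega).trans hcon.2.1)
    obtain ⟨C, hC, hCc⟩ := Finset.exists_subset_card_eq
      ((show (c : ℕ) ≤ q by omega).trans hcon.2.2)
    have hA' : ∀ z ∈ A, z ∈ S₀ ∧ z < x ∧ ¬ Meets h k l z := fun z hz =>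
      Finset.mem_filter.mp (hA hz)
    have hB' : ∀ z ∈ B, z ∈ S₀ ∧ x < z ∧ z < y ∧ ¬ Meets h k l z := fun z hz =>
      Finset.mem_filter.mp (hB hz)
    have hC' : ∀ z ∈ C, z ∈ S₀ ∧ y < z ∧ ¬ Meets h k l z := fun z hz =>
      Finset.mem_filter.mp (hC hz)
    let T := insert x (insert y (A ∪ B ∪ C))
    have hT : ∀ z, z ∈ T ↔ z = x ∨ z = y ∨ z ∈ A ∨ z ∈ B ∨ z ∈ C := by
      intro z; simp [T]
    have hxT : x ∈ T := (hT x).mpr (Or.inl rfl)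
    have hyT : y ∈ T := (hT y).mpr (Or.inr (Or.inl rfl))
    have hTA : T.filter (· < x) = A := by
      ext z
      simp only [Finset.mem_filter, hT]
      constructor
      · rintro ⟨rfl | rfl | h1 | h1 | h1, h2⟩
        · exact absurd h2 (lt_irrefl _)
        · exact absurd h2 hxy.not_gt
        · exact h1
        · exact absurd h2 (hB' z h1).2.1.not_gt
        · exact absurd h2 (hxy.trans (hC' z h1).2.1).not_gt
      · intro h1
        exact ⟨Or.inr (Or.inr (Or.inl h1)), (hA' z h1).2.1⟩
    have hTC : T.filter (y < ·) = C := by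
      ext z
      simp only [Finset.mem_filter, hT]
      constructor
      · rintro ⟨rfl | rfl | h1 | h1 | h1, h2⟩
        · exact absurd h2 hxy.not_gt
        · exact absurd h2 (lt_irrefl _)
        · exact absurd h2 ((hA' z h1).2.1.trans hxy).not_gt
        · exact absurd h2 (hB' z h1).2.2.1.not_gt
        · exact h1
      · intro h1
        exact ⟨Or.inr (Or.inr (Or.inr (Or.inr h1))), (hC' z h1).2.1⟩
    have hTB : (T.filter fun z => x < z ∧ z < y) = B := by
      ext z
      simp only [Finset.mem_filter, hT]
      constructor
      · rintro ⟨rfl | rfl | h1 | h1 | h1, h2, h3⟩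
        · exact absurd h2 (lt_irrefl _)
        · exact absurd h3 (lt_irrefl _)
        · exact absurd h2 (hA' z h1).2.1.not_gt
        · exact h1
        · exact absurd h3 (hC' z h1).2.1.not_gt
      · intro h1
        exact ⟨Or.inr (Or.inr (Or.inr (Or.inl h1))), (hB' z h1).2.1, (hB' z h1).2.2.1⟩
    have hTc : T.card = q + 2 := by
      rw [hsplit T x y hxT hyT hxy, hTA, hTB, hTC]; omega
    have hTS : T ⊆ S' := by
      intro z hz
      refine hS₀ ?_
      rcases (hT z).mp hz with rfl | rfl | h1 | h1 | h1
      exacts [hx, hy, (hA' z h1).1, (hB' z h1).1, (hC' z h1).1]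
    obtain ⟨x', hx', y', hy', hxy', h1, h2, h3, H⟩ := hcol T hTS hTc
    have below_inj : ∀ u ∈ T, ∀ v ∈ T, u < v →
        (T.filter (· < u)).card < (T.filter (· < v)).card := by
      intro u hu v hv huv
      refine Finset.card_lt_card (Finset.ssubset_iff_of_subset
        (Finset.monotone_filter_right _ fun s _ hs => lt_trans hs huv) |>.mpr ⟨u, ?_, ?_⟩)
      · exact Finset.mem_filter.mpr ⟨hu, huv⟩
      · simp
    have above_inj : ∀ u ∈ T, ∀ v ∈ T, u < v →
        (T.filter (v < ·)).card < (T.filter (u < ·)).card := by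
      intro u hu v hv huv
      refine Finset.card_lt_card (Finset.ssubset_iff_of_subset
        (Finset.monotone_filter_right _ fun s _ hs => lt_trans huv hs) |>.mpr ⟨v, ?_, ?_⟩)
      · exact Finset.mem_filter.mpr ⟨hv, huv⟩
      · simp
    have hxx : x' = x := by
      rcases lt_trichotomy x' x with h4 | h4 | h4
      · have := below_inj _ hx' _ hxT h4
        rw [h1, hTA, hAc] at this; omega
      · exact h4
      · have := below_inj _ hxT _ hx' h4
        rw [h1, hTA, hAc] at this; omega
    have hyy : y' = y := by
      rcases lt_trichotomy y' y with h4 | h4 | h4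
      · have := above_inj _ hy' _ hyT h4
        rw [h3, hTC, hCc] at this; omega
      · exact h4
      · have := above_inj _ hyT _ hy' h4
        rw [h3, hTC, hCc] at this; omega
    subst hxx hyy
    obtain ⟨z, hz, hzx, hzy, hzm⟩ := H k l hk hl hkx hky
    rcases (hT z).mp hz with rfl | rfl | h4 | h4 | h4
    exacts [hzx rfl, hzy rfl, (hA' z h4).2.2 hzm, (hB' z h4).2.2.2 hzm, (hC' z h4).2.2 hzm]

/-- A family of pairwise anticomplete induced paths disjoint from `S`; the `i`-th path has the
vertices `vert i 0, …, vert i (len i)` in this order. -/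
structure PathSystem {V : Type} (G : SimpleGraph V) (S : Set V) (ι : Type) where
  len : ι → ℕ
  vert : ι → ℕ → V
  notMem : ∀ i k, k ≤ len i → vert i k ∉ S
  adj_iff : ∀ i k i' k', k ≤ len i → k' ≤ len i' →
    (G.Adj (vert i k) (vert i' k') ↔ i = i' ∧ (k + 1 = k' ∨ k' + 1 = k))
  inj : ∀ i k i' k', k ≤ len i → k' ≤ len i' → vert i k = vert i' k' → i = i' ∧ k = k'

theorem compsOn_eq_of_mem {V : Type} {G : SimpleGraph V} {X L L' : Set V} (hL : L ∈ CompsOn G X)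
    (hL' : L' ∈ CompsOn G X) {u v : V} (hu : u ∈ L) (hv : v ∈ L') (huv : G.Adj u v ∨ u = v) :
    L = L' := by
  obtain ⟨C, rfl⟩ := hL
  obtain ⟨C', rfl⟩ := hL'
  obtain ⟨u, hu, rfl⟩ := hu
  obtain ⟨v, hv, rfl⟩ := hv
  have hr : (G.induce X).Reachable u v := by
    rcases huv with h | h
    · exact Adj.reachable (show (G.induce X).Adj u v from h)
    · rw [Subtype.ext h]
  rw [ConnectedComponent.mem_supp_iff] at hu hv
  rw [← hu, ← hv, ConnectedComponent.sound hr]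

theorem exists_pathSystem {V : Type} {G : SimpleGraph V} {S : Set V}
    (hG : IsConstellationOn G Set.univ S) :
    ∃ P : PathSystem G S (CompsOn G (Set.univ \ S)),
      ∀ i : CompsOn G (Set.univ \ S), ∀ v, v ∈ (i : Set V) ↔ ∃ k ≤ P.len i, P.vert i k = v := by
  classical
  choose n hn using fun i : CompsOn G (Set.univ \ S) => hG.comp_paths i i.2
  let φ := fun i => (hn i).some
  let e : (i : CompsOn G (Set.univ \ S)) → ℕ → (i : Set V) := fun i k =>
    (φ i).symm (Fin.ofNat (n i + 1) k)
  have he : ∀ i k, k ≤ n i → ((φ i (e i k) : Fin (n i + 1)) : ℕ) = k := fun i k hk => by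
    simp only [e, RelIso.apply_symm_apply, Fin.val_ofNat]
    exact Nat.mod_eq_of_lt (by omega)
  refine ⟨⟨n, fun i k => e i k, ?_, ?_, ?_⟩, ?_⟩
  · intro i k _
    obtain ⟨C, hC⟩ := i.2
    obtain ⟨w, -, hw⟩ := hC.subset (e i k).2
    rw [← hw]
    exact w.2.2
  · intro i k i' k' hk hk'
    constructor
    · intro h
      obtain rfl : i = i' := Subtype.ext (compsOn_eq_of_mem i.2 i'.2 (e i k).2 (e i' k').2
        (Or.inl h))
      refine ⟨rfl, ?_⟩
      have h2 := (φ i).map_rel_iff.mpr (show (G.induce (i : Set V)).Adj (e i k) (e i k') from h)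
      rwa [pathGraph_adj, he i k hk, he i k' hk'] at h2
    · rintro ⟨rfl, h⟩
      refine (φ i).map_rel_iff.mp (?_ : (pathGraph _).Adj (φ i (e i k)) (φ i (e i k')))
      rwa [pathGraph_adj, he i k hk, he i k' hk']
  · intro i k i' k' hk hk' h
    obtain rfl : i = i' := Subtype.ext (compsOn_eq_of_mem i.2 i'.2 (e i k).2 (e i' k').2
      (Or.inr h))
    refine ⟨rfl, ?_⟩
    rw [← he i k hk, ← he i k' hk', Subtype.ext h]
  · intro i v
    constructor
    · intro hv
      refine ⟨φ i ⟨v, hv⟩, Nat.lt_succ_iff.mp (φ i ⟨v, hv⟩).2, ?_⟩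
      simp [e]
    · rintro ⟨k, -, rfl⟩
      exact (e i k).2

namespace PathSystem

variable {V ι : Type} {G : SimpleGraph V} {S : Set V} (P : PathSystem G S ι)

/-- The word on the `i`-th path: a position carries its neighbours as letters. -/
def word (i : ι) (k : ℕ) (x : V) : Prop := G.Adj x (P.vert i k)

/-- The vertices of the `i`-th path at the positions `a, …, b`. -/
def segment (i : ι) (a b : ℕ) : Set V := {v | ∃ k, a ≤ k ∧ k ≤ b ∧ P.vert i k = v}

theorem isPathSet_segment {i : ι} {a b : ℕ} (hab : a ≤ b) (hb : b ≤ P.len i) :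
    IsPathSet G (P.segment i a b) := by
  let f : Fin (b - a + 1) → P.segment i a b := fun k =>
    ⟨P.vert i (a + k), a + k, by omega, by omega, rfl⟩
  have hf : Function.Bijective f := by
    constructor
    · intro k k' h
      have := (P.inj i _ i _ (by omega) (by omega) (congrArg Subtype.val h)).2
      exact Fin.ext (by omega)
    · rintro ⟨v, k, h1, h2, rfl⟩
      exact ⟨⟨k - a, by omega⟩, Subtype.ext (congrArg (P.vert i) (by simp only; omega))⟩
  refine ⟨b - a, ⟨RelIso.symm ⟨Equiv.ofBijective f hf, ?_⟩⟩⟩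
  intro k k'
  rw [pathGraph_adj]
  refine (P.adj_iff i _ i _ (by omega) (by omega)).trans ?_
  simp only [true_and]
  omega

variable (I : Set ι) (lo hi : ι → ℕ)

/-- The union of the chosen segments of the paths in `I`. -/
def union : Set V := {v | ∃ i ∈ I, v ∈ P.segment i (lo i) (hi i)}

variable {I lo hi}

theorem mem_segment_of_adj (hhi : ∀ i ∈ I, hi i ≤ P.len i) {i : ι} (hi' : i ∈ I) {u v : V}
    (hu : u ∈ P.segment i (lo i) (hi i)) (hv : v ∈ P.union I lo hi) (huv : G.Adj u v) :
    v ∈ P.segment i (lo i) (hi i) := by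
  obtain ⟨k, hk1, hk2, rfl⟩ := hu
  obtain ⟨j, hj, l, hl1, hl2, rfl⟩ := hv
  obtain ⟨rfl, -⟩ := (P.adj_iff i k j l (hk2.trans (hhi i hi')) (hl2.trans (hhi j hj))).mp huv
  exact ⟨l, hl1, hl2, rfl⟩

theorem compsOn_union (hlo : ∀ i ∈ I, lo i ≤ hi i) (hhi : ∀ i ∈ I, hi i ≤ P.len i) :
    CompsOn G (P.union I lo hi) = (fun i => P.segment i (lo i) (hi i)) '' I := by
  have hmem : ∀ i ∈ I, ∀ k, lo i ≤ k → k ≤ hi i → P.vert i k ∈ P.union I lo hi :=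
    fun i hI k h1 h2 => ⟨i, hI, k, h1, h2, rfl⟩
  have hreach : ∀ i (hI : i ∈ I), ∀ k (h1 : lo i ≤ k) (h2 : k ≤ hi i),
      (G.induce (P.union I lo hi)).Reachable
        ⟨P.vert i (lo i), hmem i hI _ le_rfl (hlo i hI)⟩ ⟨P.vert i k, hmem i hI k h1 h2⟩ := by
    intro i hI k h1
    induction k, h1 using Nat.le_induction with
    | base => exact fun _ => Reachable.refl _
    | succ k h1 ih =>
      intro h2
      refine (ih (by omega)).trans (Adj.reachable ?_)
      exact (P.adj_iff i k i (k + 1) (by have := hhi i hI; omega)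
        (h2.trans (hhi i hI))).mpr ⟨rfl, Or.inl rfl⟩
  have hstay : ∀ i ∈ I, ∀ u v : P.union I lo hi, (G.induce (P.union I lo hi)).Walk u v →
      (u : V) ∈ P.segment i (lo i) (hi i) → (v : V) ∈ P.segment i (lo i) (hi i) := by
    intro i hI u v p
    induction p with
    | nil => exact id
    | @cons u w v h p ih => exact fun hu => ih (P.mem_segment_of_adj hhi hI hu w.2 h)
  have hsupp : ∀ i (hI : i ∈ I), Subtype.val '' ((G.induce (P.union I lo hi)).connectedComponentMk
      ⟨P.vert i (lo i), hmem i hI _ le_rfl (hlo i hI)⟩).supp = P.segment i (lo i) (hi i) := by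
    intro i hI
    ext v
    constructor
    · rintro ⟨w, hw, rfl⟩
      obtain ⟨p⟩ := (ConnectedComponent.exact hw).symm
      exact hstay i hI _ _ p ⟨lo i, le_rfl, hlo i hI, rfl⟩
    · rintro ⟨k, h1, h2, rfl⟩
      exact ⟨⟨P.vert i k, hmem i hI k h1 h2⟩,
        ConnectedComponent.sound (hreach i hI k h1 h2).symm, rfl⟩
  ext L
  constructor
  · rintro ⟨C, rfl⟩
    induction C using ConnectedComponent.ind with
    | h v =>
      obtain ⟨v, i, hI, k, h1, h2, rfl⟩ := v
      refine ⟨i, hI, ?_⟩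
      rw [← ConnectedComponent.sound (hreach i hI k h1 h2), hsupp i hI]
  · rintro ⟨i, hI, rfl⟩
    exact ⟨_, (hsupp i hI).symm⟩

variable {S' : Set V}

theorem union_diff (hS' : S' ⊆ S) (hhi : ∀ i ∈ I, hi i ≤ P.len i) :
    (S' ∪ P.union I lo hi) \ S' = P.union I lo hi := by
  ext v
  simp only [Set.mem_sdiff, Set.mem_union]
  constructor
  · tauto
  · intro hv
    refine ⟨Or.inr hv, fun h => ?_⟩
    obtain ⟨i, hI, k, h1, h2, rfl⟩ := hv
    exact P.notMem i k (h2.trans (hhi i hI)) (hS' h)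

theorem isConstellationOn_union (hS' : S' ⊆ S) (hlo : ∀ i ∈ I, lo i ≤ hi i)
    (hhi : ∀ i ∈ I, hi i ≤ P.len i) (hstable : ∀ x ∈ S, ∀ y ∈ S, ¬ G.Adj x y)
    (hmeet : ∀ i ∈ I, ∀ x ∈ S', Meets (P.word i) (lo i) (hi i) x) :
    IsConstellationOn G (S' ∪ P.union I lo hi) S' where
  subset := Set.subset_union_left
  stable x hx y hy := hstable x (hS' hx) y (hS' hy)
  comp_paths L hL := by
    rw [P.union_diff hS' hhi, P.compsOn_union hlo hhi] at hL
    obtain ⟨i, hI, rfl⟩ := hL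
    exact P.isPathSet_segment (hlo i hI) (hhi i hI)
  dominates x hx L hL := by
    rw [P.union_diff hS' hhi, P.compsOn_union hlo hhi] at hL
    obtain ⟨i, hI, rfl⟩ := hL
    obtain ⟨k, h1, h2, h3⟩ := hmeet i hI x hx
    exact ⟨P.vert i k, ⟨k, h1, h2, rfl⟩, h3⟩

theorem segment_injOn (hlo : ∀ i ∈ I, lo i ≤ hi i) (hhi : ∀ i ∈ I, hi i ≤ P.len i) :
    Set.InjOn (fun i => P.segment i (lo i) (hi i)) I := by
  intro i hI j hJ hij
  have : P.vert i (lo i) ∈ P.segment j (lo j) (hi j) := by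
    rw [← show P.segment i (lo i) (hi i) = P.segment j (lo j) (hi j) from hij]
    exact ⟨lo i, le_rfl, hlo i hI, rfl⟩
  obtain ⟨k, h1, h2, h3⟩ := this
  exact (P.inj j k i (lo i) (h2.trans (hhi j hJ)) ((hlo i hI).trans (hhi i hI)) h3).1.symm

theorem exists_interval_of_walk (hS' : S' ⊆ S) (hhi : ∀ i ∈ I, hi i ≤ P.len i) {u y : V}
    (q : G.Walk u y) (hq : ∀ v ∈ q.support, v ∈ S' ∪ P.union I lo hi)
    (hy : ∀ v ∈ q.support, v ≠ y → v ∉ S') (hyS : y ∈ S') {i : ι} (hI : i ∈ I) {k : ℕ}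
    (hk1 : lo i ≤ k) (hk2 : k ≤ hi i) (hu : P.vert i k = u) :
    ∃ l, lo i ≤ l ∧ l ≤ hi i ∧ G.Adj y (P.vert i l) ∧
      ∀ m, min k l ≤ m → m ≤ max k l → P.vert i m ∈ q.support := by
  induction q generalizing k with
  | nil => exact absurd (hS' hyS) (hu ▸ P.notMem i k (hk2.trans (hhi i hI)))
  | @cons u w y h q ih =>
    by_cases hwy : w = y
    · subst hwy
      refine ⟨k, hk1, hk2, hu ▸ h.symm, fun m h1 h2 => ?_⟩
      obtain rfl : m = k := by omega
      rw [hu]; simp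
    · have hw : w ∈ (Walk.cons h q).support := by simp
      have hwS : w ∉ S' := hy w hw hwy
      obtain ⟨k', h1, h2, h3⟩ := P.mem_segment_of_adj hhi hI (u := u) ⟨k, hk1, hk2, hu⟩
        ((hq w hw).resolve_left hwS) h
      have hkk : k + 1 = k' ∨ k' + 1 = k :=
        ((P.adj_iff i k i k' (hk2.trans (hhi i hI)) (h2.trans (hhi i hI))).mp
          (by rw [hu, h3]; exact h)).2
      obtain ⟨l, h4, h5, h6, h7⟩ := ih
        (fun v hv => hq v (List.mem_cons_of_mem _ hv))
        (fun v hv => hy v (List.mem_cons_of_mem _ hv)) hyS h1 h2 h3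
      refine ⟨l, h4, h5, h6, fun m hm1 hm2 => ?_⟩
      rw [Walk.support_cons]
      by_cases hmk : m = k
      · rw [hmk, hu]; exact List.mem_cons_self
      · exact List.mem_cons_of_mem _ (h7 m (by omega) (by omega))

theorem exists_interval_of_isRoute (hS' : S' ⊆ S) (hhi : ∀ i ∈ I, hi i ≤ P.len i)
    (hstable : ∀ x ∈ S, ∀ y ∈ S, ¬ G.Adj x y) {x y : V} {p : G.Walk x y}
    (hp : IsRoute G (S' ∪ P.union I lo hi) S' p) :
    ∃ i ∈ I, ∃ k l, lo i ≤ k ∧ l ≤ hi i ∧ Meets (P.word i) k l x ∧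
      Meets (P.word i) k l y ∧ ∀ m, k ≤ m → m ≤ l → P.vert i m ∈ p.support := by
  cases p with
  | nil => exact absurd rfl hp.ne
  | @cons _ w _ h q =>
    have hw : w ∈ (Walk.cons h q).support := by simp
    have hwx : w ≠ x := h.ne'
    have hwy : w ≠ y := by
      rintro rfl
      exact hstable _ (hS' hp.fst_mem) _ (hS' hp.snd_mem) h
    obtain ⟨i, hI, k, h1, h2, h3⟩ := (hp.support_mem w hw).resolve_left
      (hp.interior w hw hwx hwy)
    have hxq := ((Walk.cons_isPath_iff h q).mp hp.isPath).2
    obtain ⟨l, h4, h5, h6, h7⟩ := P.exists_interval_of_walk hS' hhi q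
      (fun v hv => hp.support_mem v (List.mem_cons_of_mem _ hv))
      (fun v hv hvy => hp.interior v (List.mem_cons_of_mem _ hv)
        (fun hvx => hxq (hvx ▸ hv)) hvy) hp.snd_mem hI h1 h2 h3
    exact ⟨i, hI, min k l, max k l, by omega, by omega,
      ⟨k, by omega, by omega, show G.Adj x (P.vert i k) by rw [h3]; exact h⟩,
      ⟨l, by omega, by omega, h6⟩, fun m hm1 hm2 => List.mem_cons_of_mem _ (h7 m hm1 hm2)⟩

theorem dAmple_union (hS' : S' ⊆ S) (hhi : ∀ i ∈ I, hi i ≤ P.len i)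
    (hstable : ∀ x ∈ S, ∀ y ∈ S, ¬ G.Adj x y) {T : Finset V} (hT : ∀ x, x ∈ T ↔ x ∈ S') {d : ℕ}
    (ham : ∀ i ∈ I, WordAmple (P.word i) (lo i) (hi i) T d) :
    DAmple G (S' ∪ P.union I lo hi) S' d := by
  classical
  intro x y p hp
  obtain ⟨i, hI, k, l, h1, h2, hx, hy, hsupp⟩ := P.exists_interval_of_isRoute hS' hhi hstable hp
  have hdl := ham i hI x ((hT x).mpr hp.fst_mem) y ((hT y).mpr hp.snd_mem) hp.ne k l h1 h2 hx hy
  have hlen := hhi i hI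
  have hnot : ∀ z ∈ S', z ∉ (Finset.Icc k l).image (P.vert i) := by
    intro z hz hz'
    obtain ⟨m, hm, rfl⟩ := Finset.mem_image.mp hz'
    exact P.notMem i m (by have := Finset.mem_Icc.mp hm; omega) (hS' hz)
  have hsub : insert x (insert y ((Finset.Icc k l).image (P.vert i))) ⊆ p.support.toFinset := by
    intro z hz
    rw [List.mem_toFinset]
    simp only [Finset.mem_insert] at hz
    rcases hz with rfl | rfl | hz
    · simp
    · simp
    · obtain ⟨m, hm, rfl⟩ := Finset.mem_image.mp hz
      exact hsupp m (Finset.mem_Icc.mp hm).1 (Finset.mem_Icc.mp hm).2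
  have hcard := (Finset.card_le_card hsub).trans (List.toFinset_card_le _)
  rw [Walk.length_support, Finset.card_insert_of_notMem, Finset.card_insert_of_notMem
    (hnot y hp.snd_mem), Finset.card_image_of_injOn, Nat.card_Icc] at hcard
  · omega
  · intro m hm m' hm' h
    have hm := Finset.mem_Icc.mp hm
    have hm' := Finset.mem_Icc.mp hm'
    exact (P.inj i m i m' (by omega) (by omega) h).2
  · simp only [Finset.mem_insert, not_or]
    exact ⟨hp.ne, hnot x hp.fst_mem⟩

end PathSystem

theorem exists_strictMono_nat (V : Type) [LinearOrder V] [Fintype V] :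
    ∃ (f : V → ℕ) (n : ℕ), StrictMono f ∧ ∀ x, f x < n :=
  ⟨fun x => (Fintype.orderIsoFinOfCardEq V rfl).symm x, Fintype.card V,
    fun _ _ h => (Fintype.orderIsoFinOfCardEq V rfl).symm.strictMono h,
    fun x => ((Fintype.orderIsoFinOfCardEq V rfl).symm x).2⟩

namespace PathSystem

variable {V ι : Type} {G : SimpleGraph V} {S : Set V} (P : PathSystem G S ι) {I : Set ι}
  {lo hi : ι → ℕ} {S' : Set V}

theorem sitsIn_union (hS' : S' ⊆ S) (hlo : ∀ i ∈ I, lo i ≤ hi i)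
    (hhi : ∀ i ∈ I, hi i ≤ P.len i) (e : ι → Set V) (he : Function.Injective e)
    (hmem : ∀ i, e i ∈ CompsOn G (Set.univ \ S))
    (hP : ∀ i v, v ∈ e i ↔ ∃ k ≤ P.len i, P.vert i k = v) :
    SitsIn G (S' ∪ P.union I lo hi) S' Set.univ S := by
  have hsub : ∀ i ∈ I, P.segment i (lo i) (hi i) ⊆ e i := by
    rintro i hI _ ⟨k, -, h2, rfl⟩
    exact (hP i _).mpr ⟨k, h2.trans (hhi i hI), rfl⟩
  refine ⟨Set.subset_univ _, hS', ?_, ?_⟩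
  · intro L hL
    rw [P.union_diff hS' hhi, P.compsOn_union hlo hhi] at hL
    obtain ⟨i, hI, rfl⟩ := hL
    exact ⟨e i, hmem i, hsub i hI⟩
  · intro M hM L₁ hL₁ L₂ hL₂ h₁ h₂
    rw [P.union_diff hS' hhi, P.compsOn_union hlo hhi] at hL₁ hL₂
    obtain ⟨i, hI, rfl⟩ := hL₁
    obtain ⟨j, hJ, rfl⟩ := hL₂
    have key : ∀ i ∈ I, P.segment i (lo i) (hi i) ⊆ M → e i = M := fun i hI h =>
      have hv : P.vert i (lo i) ∈ P.segment i (lo i) (hi i) := ⟨lo i, le_rfl, hlo i hI, rfl⟩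
      compsOn_eq_of_mem (hmem i) hM (hsub i hI hv) (h hv) (Or.inr rfl)
    obtain rfl : i = j := he ((key i hI h₁).trans (key j hJ h₂).symm)
    rfl

theorem ncard_compsOn_union (hS' : S' ⊆ S) (hlo : ∀ i ∈ I, lo i ≤ hi i)
    (hhi : ∀ i ∈ I, hi i ≤ P.len i) :
    (CompsOn G ((S' ∪ P.union I lo hi) \ S')).ncard = I.ncard := by
  rw [P.union_diff hS' hhi, P.compsOn_union hlo hhi,
    (P.segment_injOn hlo hhi).ncard_image]

variable [LinearOrder V] [Fintype V] {T : Finset V}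

theorem interrupted_union_of_wordUp (hS' : S' ⊆ S) (hhi : ∀ i ∈ I, hi i ≤ P.len i)
    (hstable : ∀ x ∈ S, ∀ y ∈ S, ¬ G.Adj x y) (hT : ∀ x, x ∈ T ↔ x ∈ S')
    (h : ∀ i ∈ I, WordUp (P.word i) (lo i) (hi i) T) :
    Interrupted G (S' ∪ P.union I lo hi) S' := by
  obtain ⟨f, -, hf, -⟩ := exists_strictMono_nat V
  refine ⟨f, hf.injective.injOn, fun x hx y hy z hz hxy hyz p hp => ?_⟩
  obtain ⟨i, hI, k, l, h1, h2, hkx, hky, hsupp⟩ :=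
    P.exists_interval_of_isRoute hS' hhi hstable hp
  obtain ⟨m, hm1, hm2, hm⟩ := h i hI x ((hT x).mpr hx) y ((hT y).mpr hy) z ((hT z).mpr hz)
    (hf.lt_iff_lt.mp hxy) (hf.lt_iff_lt.mp hyz) k l h1 h2 hkx hky
  exact ⟨_, hsupp m hm1 hm2, hm⟩

theorem interrupted_union_of_wordDown (hS' : S' ⊆ S) (hhi : ∀ i ∈ I, hi i ≤ P.len i)
    (hstable : ∀ x ∈ S, ∀ y ∈ S, ¬ G.Adj x y) (hT : ∀ x, x ∈ T ↔ x ∈ S')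
    (h : ∀ i ∈ I, WordDown (P.word i) (lo i) (hi i) T) :
    Interrupted G (S' ∪ P.union I lo hi) S' := by
  obtain ⟨f, n, hf, hn⟩ := exists_strictMono_nat V
  have hlt : ∀ x y, n - f x < n - f y → y < x := fun x y hxy =>
    hf.lt_iff_lt.mp (by omega)
  refine ⟨fun x => n - f x, fun x _ y _ hxy => hf.injective ?_,
    fun x hx y hy z hz hxy hyz p hp => ?_⟩
  · have := hn x
    have := hn y
    simp only at hxy
    omega
  obtain ⟨i, hI, k, l, h1, h2, hkx, hky, hsupp⟩ :=
    P.exists_interval_of_isRoute hS' hhi hstable hp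
  obtain ⟨m, hm1, hm2, hm⟩ := h i hI y ((hT y).mpr hy) x ((hT x).mpr hx) z ((hT z).mpr hz)
    (hlt _ _ hxy) (hlt _ _ hyz) k l h1 h2 hky hkx
  exact ⟨_, hsupp m hm1 hm2, hm⟩

theorem zigzagged_union (hS' : S' ⊆ S) (hhi : ∀ i ∈ I, hi i ≤ P.len i)
    (hstable : ∀ x ∈ S, ∀ y ∈ S, ¬ G.Adj x y) (hT : ∀ x, x ∈ T ↔ x ∈ S') {q : ℕ}
    (h : ∀ i ∈ I, WordMixed (P.word i) (lo i) (hi i) T 0 q 0) :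
    Zigzagged G (S' ∪ P.union I lo hi) S' q := by
  classical
  obtain ⟨f, -, hf, -⟩ := exists_strictMono_nat V
  refine ⟨f, hf.injective.injOn, fun x hx y hy hxy p hp => ?_⟩
  obtain ⟨i, hI, k, l, h1, h2, hkx, hky, hsupp⟩ :=
    P.exists_interval_of_isRoute hS' hhi hstable hp
  have hlt := ((h i hI x ((hT x).mpr hx) y ((hT y).mpr hy) (hf.lt_iff_lt.mp hxy) k l h1 h2 hkx
    hky).resolve_left (Nat.not_lt_zero _)).resolve_right (Nat.not_lt_zero _)
  refine lt_of_le_of_lt ?_ hlt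
  rw [← Set.ncard_coe_finset]
  refine Set.ncard_le_ncard ?_ (Finset.finite_toSet _)
  rintro z ⟨hz, hxz, hzy, hno⟩
  rw [Finset.mem_coe, Finset.mem_filter]
  refine ⟨(hT z).mpr hz, hf.lt_iff_lt.mp hxz, hf.lt_iff_lt.mp hzy, ?_⟩
  rintro ⟨m, hm1, hm2, hm⟩
  exact hno ⟨_, hsupp m hm1 hm2, hm⟩

end PathSystem

theorem hasInducedSubgraphIso_completeBipartiteGraph {V : Type} {G : SimpleGraph V} {r : ℕ}
    (a b : Fin r → V) (ha : Function.Injective a) (hb : Function.Injective b)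
    (haa : ∀ i j, ¬ G.Adj (a i) (a j)) (hbb : ∀ i j, ¬ G.Adj (b i) (b j))
    (hab : ∀ i j, G.Adj (a i) (b j)) :
    HasInducedSubgraphIso G (completeBipartiteGraph (Fin r) (Fin r)) := by
  have hinj : Function.Injective (Sum.elim a b) :=
    ha.sumElim hb fun i j => (hab i j).ne
  refine ⟨Set.range (Sum.elim a b), ⟨⟨Equiv.ofInjective _ hinj, ?_⟩⟩⟩
  rintro (i | i) (j | j)
  · simpa using haa i j
  · simpa using hab i j
  · simpa using (hab j i).symm
  · simpa using hbb i j

theorem exists_walk_of_seq {U : Type} {H : SimpleGraph U} (a : ℕ → U) (n : ℕ)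
    (hadj : ∀ k < n, H.Adj (a k) (a (k + 1))) :
    ∃ w : H.Walk (a 0) (a n), w.length = n ∧ w.support = (List.range (n + 1)).map a ∧
      ∀ k < n, w.toSubgraph.Adj (a k) (a (k + 1)) := by
  induction n with
  | zero => exact ⟨Walk.nil, rfl, rfl, fun k hk => absurd hk (Nat.not_lt_zero k)⟩
  | succ n ih =>
    obtain ⟨w, h1, h2, h3⟩ := ih fun k hk => hadj k (by omega)
    have h := hadj n (by omega)
    refine ⟨w.concat h, by simp [h1], ?_, fun k hk => ?_⟩
    · rw [Walk.support_concat, h2, List.range_succ (n := n + 1)]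
      simp
    · rw [Walk.concat_eq_append, Walk.toSubgraph_append, Subgraph.sup_adj]
      rcases Nat.lt_succ_iff_lt_or_eq.mp hk with hk | rfl
      · exact Or.inl (h3 k hk)
      · right
        simp

/-- A stable set of branch vertices, together with pairwise anticomplete paths that each link its
own pair of branch vertices, induces a proper subdivision of a complete graph. -/
theorem exists_isSubdivisionWith_top {V : Type} {G : SimpleGraph V} {m : ℕ} (b : Fin m → V)
    (hb : Function.Injective b) (hbb : ∀ u v, ¬ G.Adj (b u) (b v))
    (len : {e : Fin m × Fin m // e.1 < e.2} → ℕ)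
    (q : {e : Fin m × Fin m // e.1 < e.2} → ℕ → V)
    (hqb : ∀ e k w, k ≤ len e → q e k ≠ b w)
    (hbq : ∀ e k w, k ≤ len e →
      (G.Adj (b w) (q e k) ↔ (w = e.1.1 ∧ k = 0) ∨ (w = e.1.2 ∧ k = len e)))
    (hqq : ∀ e k e' k', k ≤ len e → k' ≤ len e' →
      (G.Adj (q e k) (q e' k') ↔ e = e' ∧ (k + 1 = k' ∨ k' + 1 = k)))
    (hq : ∀ e k e' k', k ≤ len e → k' ≤ len e' → q e k = q e' k' → e = e' ∧ k = k') :
    ∃ X : Set V, IsSubdivisionWith (G.induce X) (⊤ : SimpleGraph (Fin m)) (fun n => 2 ≤ n) := by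
  classical
  set X : Set V := {v | (∃ w, b w = v) ∨ ∃ e, ∃ k ≤ len e, q e k = v} with hX
  let β : Fin m → X := fun w => ⟨b w, Or.inl ⟨w, rfl⟩⟩
  let a : {e : Fin m × Fin m // e.1 < e.2} → ℕ → X := fun e k =>
    if k = 0 then β e.1.1 else
      if hk : k - 1 ≤ len e then ⟨q e (k - 1), Or.inr ⟨e, k - 1, hk, rfl⟩⟩ else β e.1.2
  have ha0 : ∀ e, a e 0 = β e.1.1 := fun e => by simp [a]
  have haq : ∀ e k, k ≤ len e → (a e (k + 1) : V) = q e k := fun e k hk => by simp [a, hk]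
  have hal : ∀ e, a e (len e + 2) = β e.1.2 := fun e => by simp [a]
  have hadj : ∀ e, ∀ k < len e + 2, (G.induce X).Adj (a e k) (a e (k + 1)) := by
    intro e k hk
    change G.Adj (a e k) (a e (k + 1))
    rcases Nat.eq_zero_or_pos k with rfl | hpos
    · rw [ha0, haq e 0 (Nat.zero_le _)]
      exact (hbq e 0 _ (Nat.zero_le _)).mpr (Or.inl ⟨rfl, rfl⟩)
    · obtain ⟨k, rfl⟩ := Nat.exists_eq_succ_of_ne_zero hpos.ne'
      rcases (show k = len e ∨ k + 1 ≤ len e by omega) with rfl | hk'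
      · rw [haq e _ le_rfl, hal]
        exact ((hbq e _ _ le_rfl).mpr (Or.inr ⟨rfl, rfl⟩)).symm
      · rw [haq e k (by omega), haq e (k + 1) hk']
        exact (hqq e k e (k + 1) (by omega) hk').mpr ⟨rfl, Or.inl rfl⟩
  have hW : ∀ e, ∃ w : (G.induce X).Walk (β e.1.1) (β e.1.2), w.length = len e + 2 ∧
      w.support = (List.range (len e + 3)).map (a e) ∧
      ∀ k < len e + 2, w.toSubgraph.Adj (a e k) (a e (k + 1)) := by
    intro e
    rw [← ha0, ← hal]
    exact exists_walk_of_seq (a e) (len e + 2) (hadj e)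
  choose W hWlen hWsupp hWadj using hW
  have hmem : ∀ e x, x ∈ (W e).support →
      x = β e.1.1 ∨ x = β e.1.2 ∨ ∃ k ≤ len e, (x : V) = q e k := by
    intro e x hx
    rw [hWsupp, List.mem_map] at hx
    obtain ⟨k, hk, rfl⟩ := hx
    rw [List.mem_range] at hk
    rcases Nat.eq_zero_or_pos k with rfl | hpos
    · exact Or.inl (ha0 e)
    · obtain ⟨k, rfl⟩ := Nat.exists_eq_succ_of_ne_zero hpos.ne'
      rcases (show k = len e + 1 ∨ k ≤ len e by omega) with rfl | hk'
      · exact Or.inr (Or.inl (hal e))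
      · exact Or.inr (Or.inr ⟨k, hk', haq e k hk'⟩)
  have hWpath : ∀ e, (W e).IsPath := by
    intro e
    rw [Walk.isPath_def, hWsupp]
    refine List.Nodup.map_on ?_ List.nodup_range
    have hkind : ∀ k < len e + 3, k = 0 ∨ k = len e + 2 ∨ ∃ j ≤ len e, k = j + 1 := by
      intro k hk
      rcases Nat.eq_zero_or_pos k with rfl | hpos
      · exact Or.inl rfl
      · rcases (show k = len e + 2 ∨ k - 1 ≤ len e by omega) with h | h
        · exact Or.inr (Or.inl h)
        · exact Or.inr (Or.inr ⟨k - 1, h, by omega⟩)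
    have hne : β e.1.1 ≠ β e.1.2 := fun h => e.2.ne (hb (congrArg Subtype.val h))
    have hqβ : ∀ j ≤ len e, ∀ w, a e (j + 1) ≠ β w := fun j hj w h =>
      hqb e j w hj (by rw [← haq e j hj, h])
    intro k hk k' hk' hkk
    rw [List.mem_range] at hk hk'
    rcases hkind k hk with rfl | rfl | ⟨j, hj, rfl⟩ <;>
      rcases hkind k' hk' with rfl | rfl | ⟨j', hj', rfl⟩
    · rfl
    · rw [ha0, hal] at hkk; exact absurd hkk hne
    · rw [ha0] at hkk; exact absurd hkk.symm (hqβ j' hj' _)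
    · rw [ha0, hal] at hkk; exact absurd hkk.symm hne
    · rfl
    · rw [hal] at hkk; exact absurd hkk.symm (hqβ j' hj' _)
    · rw [ha0] at hkk; exact absurd hkk (hqβ j hj _)
    · rw [hal] at hkk; exact absurd hkk (hqβ j hj _)
    · have := (hq e j e j' hj hj' (by rw [← haq e j hj, ← haq e j' hj', hkk])).2
      rw [this]
  let path : ∀ ⦃u v : Fin m⦄, (⊤ : SimpleGraph (Fin m)).Adj u v →
      (G.induce X).Walk (β u) (β v) := fun u v h =>
    if huv : u < v then W ⟨(u, v), huv⟩
    else (W ⟨(v, u), lt_of_le_of_ne (not_lt.mp huv) h.ne'⟩).reverse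
  have hpath : ∀ ⦃u v : Fin m⦄ (h : (⊤ : SimpleGraph (Fin m)).Adj u v),
      ∃ e : {e : Fin m × Fin m // e.1 < e.2},
        ((u = e.1.1 ∧ v = e.1.2) ∨ (u = e.1.2 ∧ v = e.1.1)) ∧
        (∀ x, x ∈ (path h).support ↔ x ∈ (W e).support) ∧
        (path h).length = (W e).length ∧ (path h).IsPath := by
    intro u v h
    by_cases huv : u < v
    · refine ⟨⟨(u, v), huv⟩, Or.inl ⟨rfl, rfl⟩, ?_⟩
      rw [show path h = W ⟨(u, v), huv⟩ from dif_pos huv]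
      exact ⟨fun _ => Iff.rfl, rfl, hWpath _⟩
    · refine ⟨⟨(v, u), lt_of_le_of_ne (not_lt.mp huv) h.ne'⟩, Or.inr ⟨rfl, rfl⟩, ?_⟩
      rw [show path h = (W ⟨(v, u), _⟩).reverse from dif_neg huv]
      exact ⟨fun x => by simp, Walk.length_reverse _, (hWpath _).reverse⟩
  have hpathW : ∀ e : {e : Fin m × Fin m // e.1 < e.2},
      path (show (⊤ : SimpleGraph (Fin m)).Adj e.1.1 e.1.2 from e.2.ne) = W e := by
    intro e
    simp only [path, dif_pos e.2]
  have hinner : ∀ ⦃u v : Fin m⦄ (h : (⊤ : SimpleGraph (Fin m)).Adj u v)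
      (e : {e : Fin m × Fin m // e.1 < e.2}),
      ((u = e.1.1 ∧ v = e.1.2) ∨ (u = e.1.2 ∧ v = e.1.1)) →
      ∀ x ∈ (W e).support, x ≠ β u → x ≠ β v → ∃ k ≤ len e, (x : V) = q e k := by
    intro u v h e he x hx hxu hxv
    rcases hmem e x hx with h1 | h1 | h1
    · rcases he with ⟨rfl, rfl⟩ | ⟨rfl, rfl⟩
      · exact absurd h1 hxu
      · exact absurd h1 hxv
    · rcases he with ⟨rfl, rfl⟩ | ⟨rfl, rfl⟩
      · exact absurd h1 hxv
      · exact absurd h1 hxu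
    · exact h1
  have hedge : ∀ e, ∀ k < len e + 2, ∀ x y : X, x = a e k → y = a e (k + 1) →
      ∃ (u v : Fin m) (h : (⊤ : SimpleGraph (Fin m)).Adj u v),
        (path h).toSubgraph.Adj x y ∧ (path h).toSubgraph.Adj y x := by
    rintro e k hk _ _ rfl rfl
    refine ⟨e.1.1, e.1.2, e.2.ne, ?_⟩
    rw [hpathW]
    exact ⟨hWadj e k hk, (hWadj e k hk).symm⟩
  have hbqedge : ∀ w e k, k ≤ len e → ∀ x y : X, (x : V) = b w → (y : V) = q e k →
      G.Adj (b w) (q e k) → ∃ (u v : Fin m) (h : (⊤ : SimpleGraph (Fin m)).Adj u v),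
        (path h).toSubgraph.Adj x y ∧ (path h).toSubgraph.Adj y x := by
    intro w e k hk x y hx hy h
    rcases (hbq e k w hk).mp h with ⟨rfl, rfl⟩ | ⟨rfl, rfl⟩
    · exact hedge e 0 (by omega) x y ((Subtype.ext hx).trans (ha0 e).symm)
        (Subtype.ext (hy.trans (haq e 0 hk).symm))
    · obtain ⟨u, v, h, h1, h2⟩ := hedge e (len e + 1) (by omega) y x
        (Subtype.ext (hy.trans (haq e _ le_rfl).symm)) ((Subtype.ext hx).trans (hal e).symm)
      exact ⟨u, v, h, h2, h1⟩
  refine ⟨X, ⟨⟨β, fun u v h => hb (congrArg Subtype.val h), path, ?_, ?_, ?_, ?_, ?_, ?_, ?_⟩⟩⟩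
  · intro u v h
    obtain ⟨e, -, -, -, h1⟩ := hpath h
    exact h1
  · intro u v h
    obtain ⟨e, -, -, h1, -⟩ := hpath h
    simp only [h1, hWlen]
    omega
  · intro u v h
    rcases lt_or_gt_of_ne h.ne with huv | huv
    · simp only [path, dif_pos huv, dif_neg huv.not_gt]
    · simp only [path, dif_pos huv, dif_neg huv.not_gt, Walk.reverse_reverse]
  · intro u v h w hw
    obtain ⟨e, he, h1, -, -⟩ := hpath h
    rcases hmem e _ ((h1 _).mp hw) with h2 | h2 | ⟨k, hk, h2⟩
    · have := hb (congrArg Subtype.val h2)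
      rcases he with ⟨rfl, rfl⟩ | ⟨rfl, rfl⟩
      · exact Or.inl this
      · exact Or.inr this
    · have := hb (congrArg Subtype.val h2)
      rcases he with ⟨rfl, rfl⟩ | ⟨rfl, rfl⟩
      · exact Or.inr this
      · exact Or.inl this
    · exact absurd h2.symm (hqb e k w hk)
  · intro u v u' v' h h' hne x hx hxu hxv y hy hyu hyv
    obtain ⟨e, he, h1, -, -⟩ := hpath h
    obtain ⟨e', he', h1', -, -⟩ := hpath h'
    obtain ⟨k, hk, hxk⟩ := hinner h e he x ((h1 x).mp hx) hxu hxv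
    obtain ⟨k', hk', hyk⟩ := hinner h' e' he' y ((h1' y).mp hy) hyu hyv
    have hee : e ≠ e' := by
      rintro rfl
      refine hne ?_
      rcases he with ⟨rfl, rfl⟩ | ⟨rfl, rfl⟩ <;> rcases he' with ⟨rfl, rfl⟩ | ⟨rfl, rfl⟩ <;>
        simp [Sym2.eq_swap]
    constructor
    · rintro rfl
      exact hee (hq e k e' k' hk hk' (hxk.symm.trans hyk)).1
    · intro hxy
      have hxy : G.Adj x y := hxy
      rw [hxk, hyk] at hxy
      exact hee ((hqq e k e' k' hk hk').mp hxy).1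
  · rintro ⟨x, ⟨w, hw⟩ | ⟨e, k, hk, hx⟩⟩
    · exact Or.inl ⟨w, Subtype.ext hw.symm⟩
    · refine Or.inr ⟨e.1.1, e.1.2, e.2.ne, ?_⟩
      rw [hpathW, hWsupp, List.mem_map]
      exact ⟨k + 1, List.mem_range.mpr (by omega), Subtype.ext ((haq e k hk).trans hx)⟩
  · intro x y hxy
    have hxy : G.Adj x y := hxy
    obtain ⟨w, hw⟩ | ⟨e, k, hk, hx⟩ := x.2 <;> obtain ⟨w', hw'⟩ | ⟨e', k', hk', hy⟩ := y.2
    · rw [← hw, ← hw'] at hxy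
      exact absurd hxy (hbb w w')
    · rw [← hw, ← hy] at hxy
      obtain ⟨u, v, h, h1, -⟩ := hbqedge w e' k' hk' x y hw.symm hy.symm hxy
      exact ⟨u, v, h, h1⟩
    · rw [← hx, ← hw'] at hxy
      obtain ⟨u, v, h, -, h1⟩ := hbqedge w' e k hk y x hw'.symm hx.symm hxy.symm
      exact ⟨u, v, h, h1⟩
    · rw [← hx, ← hy] at hxy
      obtain ⟨rfl, rfl | rfl⟩ := (hqq e k e' k' hk hk').mp hxy
      · obtain ⟨u, v, h, h1, -⟩ := hedge e (k + 1) (by omega) x y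
          (Subtype.ext (hx.symm.trans (haq e k hk).symm))
          (Subtype.ext (hy.symm.trans (haq e _ hk').symm))
        exact ⟨u, v, h, h1⟩
      · obtain ⟨u, v, h, -, h1⟩ := hedge e (k' + 1) (by omega) y x
          (Subtype.ext (hy.symm.trans (haq e k' hk').symm))
          (Subtype.ext (hx.symm.trans (haq e _ hk).symm))
        exact ⟨u, v, h, h1⟩

namespace PathSystem

variable {V ι : Type} {G : SimpleGraph V} {S : Set V} (P : PathSystem G S ι)

theorem exists_link {i : ι} {i' j' : ℕ} {x y : V}
    (hx : Meets (P.word i) i' j' x) (hy : Meets (P.word i) i' j' y) :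
    ∃ (l : ℕ) (c : ℕ → ℕ), (∀ k ≤ l, i' ≤ c k ∧ c k ≤ j') ∧
      (∀ k ≤ l, G.Adj x (P.vert i (c k)) ↔ k = 0) ∧
      (∀ k ≤ l, G.Adj y (P.vert i (c k)) ↔ k = l) ∧
      (∀ k ≤ l, ∀ k' ≤ l, (c k + 1 = c k' ∨ c k' + 1 = c k) ↔ (k + 1 = k' ∨ k' + 1 = k)) ∧
      (∀ k ≤ l, ∀ k' ≤ l, c k = c k' → k = k') := by
  classical
  have hex : ∃ l k₁ k₂, i' ≤ k₁ ∧ k₁ ≤ j' ∧ i' ≤ k₂ ∧ k₂ ≤ j' ∧ G.Adj x (P.vert i k₁) ∧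
      G.Adj y (P.vert i k₂) ∧ (k₁ + l = k₂ ∨ k₂ + l = k₁) := by
    obtain ⟨k₁, h1, h2, h3⟩ := hx
    obtain ⟨k₂, h4, h5, h6⟩ := hy
    exact ⟨(k₁ - k₂) + (k₂ - k₁), k₁, k₂, h1, h2, h4, h5, h3, h6, by omega⟩
  obtain ⟨k₁, k₂, h1, h2, h3, h4, h5, h6, h7⟩ := Nat.find_spec hex
  have hmin : ∀ l < Nat.find hex, ∀ k₁ k₂, i' ≤ k₁ → k₁ ≤ j' → i' ≤ k₂ → k₂ ≤ j' →
      G.Adj x (P.vert i k₁) → G.Adj y (P.vert i k₂) → ¬ (k₁ + l = k₂ ∨ k₂ + l = k₁) :=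
    fun l hl k₁ k₂ a1 a2 a3 a4 a5 a6 a7 =>
      Nat.find_min hex hl ⟨k₁, k₂, a1, a2, a3, a4, a5, a6, a7⟩
  generalize Nat.find hex = l at h7 hmin
  have main : ∀ c : ℕ → ℕ, c 0 = k₁ → c l = k₂ →
      ((∀ k ≤ l, c k = k₁ + k) ∨ (∀ k ≤ l, c k + k = k₁)) →
      (∀ k ≤ l, i' ≤ c k ∧ c k ≤ j') ∧
      (∀ k ≤ l, G.Adj x (P.vert i (c k)) ↔ k = 0) ∧
      (∀ k ≤ l, G.Adj y (P.vert i (c k)) ↔ k = l) ∧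
      (∀ k ≤ l, ∀ k' ≤ l, (c k + 1 = c k' ∨ c k' + 1 = c k) ↔ (k + 1 = k' ∨ k' + 1 = k)) ∧
      (∀ k ≤ l, ∀ k' ≤ l, c k = c k' → k = k') := by
    intro c hc0 hcl hc
    have hrange : ∀ k ≤ l, i' ≤ c k ∧ c k ≤ j' := by
      intro k hk
      rcases hc with hc | hc
      · have := hc k hk; have := hc l le_rfl; omega
      · have := hc k hk; have := hc l le_rfl; omega
    refine ⟨hrange, fun k hk => ⟨fun h => ?_, ?_⟩, fun k hk => ⟨fun h => ?_, ?_⟩,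
      fun k hk k' hk' => ?_, fun k hk k' hk' h => ?_⟩
    · by_contra h0
      refine hmin (l - k) (by omega) (c k) k₂ (hrange k hk).1 (hrange k hk).2 h3 h4 h h6 ?_
      rcases hc with hc | hc
      · have := hc k hk; have := hc l le_rfl; omega
      · have := hc k hk; have := hc l le_rfl; omega
    · rintro rfl; rwa [hc0]
    · by_contra h0
      refine hmin k (by omega) k₁ (c k) h1 h2 (hrange k hk).1 (hrange k hk).2 h5 h ?_
      rcases hc with hc | hc
      · have := hc k hk; omega
      · have := hc k hk; omega
    · rintro rfl; rwa [hcl]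
    · rcases hc with hc | hc
      · have := hc k hk; have := hc k' hk'; omega
      · have := hc k hk; have := hc k' hk'; omega
    · rcases hc with hc | hc
      · have := hc k hk; have := hc k' hk'; omega
      · have := hc k hk; have := hc k' hk'; omega
  rcases h7 with h7 | h7
  · exact ⟨l, fun k => k₁ + k, main _ rfl h7 (Or.inl fun k _ => rfl)⟩
  · exact ⟨l, fun k => k₁ - k, main _ rfl (by omega) (Or.inr fun k _ => by omega)⟩

/-- Enough paths on which every pair of a stable set of size `m` can be linked while avoiding the
rest of that set yield a proper subdivision of the complete graph on `m` vertices. -/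
theorem exists_isSubdivisionWith_of_wordFull {m : ℕ} {T : Finset V} (hT : T.card = m)
    (hTS : ∀ x ∈ T, x ∈ S) (hstable : ∀ x ∈ S, ∀ y ∈ S, ¬ G.Adj x y)
    {F : Finset ι} (hF : m * m ≤ F.card)
    (hfull : ∀ i ∈ F, WordFull (P.word i) 0 (P.len i) T) :
    ∃ X : Set V, IsSubdivisionWith (G.induce X) (⊤ : SimpleGraph (Fin m)) (fun n => 2 ≤ n) := by
  let b : Fin m → V := fun u => (T.equivFinOfCardEq hT).symm u
  have hb : Function.Injective b := fun u v h =>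
    (T.equivFinOfCardEq hT).symm.injective (Subtype.ext h)
  have hbT : ∀ u, b u ∈ T := fun u => ((T.equivFinOfCardEq hT).symm u).2
  obtain ⟨g⟩ : Nonempty (Fin m × Fin m ↪ F) :=
    Function.Embedding.nonempty_of_card_le (by simpa using hF)
  have hlink : ∀ e : {e : Fin m × Fin m // e.1 < e.2}, ∃ (l : ℕ) (c : ℕ → ℕ),
      (∀ k ≤ l, c k ≤ P.len (g e.1)) ∧
      (∀ w, ∀ k ≤ l, G.Adj (b w) (P.vert (g e.1) (c k)) ↔
        (w = e.1.1 ∧ k = 0) ∨ (w = e.1.2 ∧ k = l)) ∧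
      (∀ k ≤ l, ∀ k' ≤ l, (c k + 1 = c k' ∨ c k' + 1 = c k) ↔ (k + 1 = k' ∨ k' + 1 = k)) ∧
      (∀ k ≤ l, ∀ k' ≤ l, c k = c k' → k = k') := by
    intro e
    have hne : b e.1.1 ≠ b e.1.2 := fun h => e.2.ne (hb h)
    obtain ⟨i', j', h1, h2, h3, h4, h5⟩ := hfull (g e.1) (g e.1).2 _ (hbT e.1.1) _ (hbT e.1.2) hne
    obtain ⟨l, c, hc1, hc2, hc3, hc4, hc5⟩ := P.exists_link h3 h4
    refine ⟨l, c, fun k hk => (hc1 k hk).2.trans h2, fun w k hk => ?_, hc4, hc5⟩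
    by_cases hw1 : w = e.1.1
    · subst hw1
      rw [hc2 k hk]
      simp [e.2.ne]
    by_cases hw2 : w = e.1.2
    · subst hw2
      rw [hc3 k hk]
      simp [e.2.ne']
    simp only [hw1, hw2, false_and, or_false, iff_false]
    intro h
    exact h5 (b w) (hbT w) (fun h => hw1 (hb h)) (fun h => hw2 (hb h))
      ⟨c k, (hc1 k hk).1, (hc1 k hk).2, h⟩
  choose l c hc1 hc2 hc3 hc4 using hlink
  have hg : ∀ e e' : {e : Fin m × Fin m // e.1 < e.2}, (g e.1 : ι) = g e'.1 → e = e' :=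
    fun e e' h => Subtype.ext (g.injective (Subtype.ext h))
  refine exists_isSubdivisionWith_top b hb (fun u v => hstable _ (hTS _ (hbT u)) _ (hTS _ (hbT v)))
    l (fun e k => P.vert (g e.1) (c e k)) ?_ (fun e k w => hc2 e w k) ?_ ?_
  · intro e k w hk h
    exact P.notMem _ _ (hc1 e k hk) (h ▸ hTS _ (hbT w))
  · intro e k e' k' hk hk'
    rw [P.adj_iff _ _ _ _ (hc1 e k hk) (hc1 e' k' hk')]
    constructor
    · rintro ⟨h, h'⟩
      obtain rfl := hg e e' h
      exact ⟨rfl, (hc3 e k hk k' hk').mp h'⟩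
    · rintro ⟨rfl, h'⟩
      exact ⟨rfl, (hc3 e k hk k' hk').mpr h'⟩
  · intro e k e' k' hk hk' h
    obtain ⟨h1, h2⟩ := P.inj _ _ _ _ (hc1 e k hk) (hc1 e' k' hk') h
    obtain rfl := hg e e' h1
    exact ⟨rfl, hc4 e k hk k' hk' h2⟩

/-- Many paths with a vertex adjacent to `r` elements of a bounded subset of `S` yield `K_{r,r}`. -/
theorem hasInducedSubgraphIso_completeBipartiteGraph
    (hstable : ∀ x ∈ S, ∀ y ∈ S, ¬ G.Adj x y) {T : Finset V} (hT : ∀ x ∈ T, x ∈ S)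
    {B : Finset ι} {r : ℕ} (hB : 2 ^ T.card * r ≤ B.card)
    (h : ∀ i ∈ B, ∃ k ≤ P.len i, ∃ R ⊆ T, (∀ x ∈ R, P.word i k x) ∧ r ≤ R.card) :
    HasInducedSubgraphIso G (completeBipartiteGraph (Fin r) (Fin r)) := by
  classical
  have h' : ∀ i, ∃ R ⊆ T, i ∈ B → r ≤ R.card ∧ ∃ k ≤ P.len i, ∀ x ∈ R, P.word i k x := by
    intro i
    by_cases hi : i ∈ B
    · obtain ⟨k, hk, R, hR, h1, h2⟩ := h i hi
      exact ⟨R, hR, fun _ => ⟨h2, k, hk, h1⟩⟩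
    · exact ⟨∅, Finset.empty_subset T, fun h => absurd h hi⟩
  choose R hRT hR using h'
  obtain ⟨A, hA, hcard⟩ := Finset.exists_le_card_fiber_of_mul_le_card_of_maps_to
    (s := B) (t := T.powerset) (f := R) (n := r)
    (fun i _ => Finset.mem_powerset.mpr (hRT i)) ⟨∅, Finset.empty_mem_powerset T⟩
    (by rwa [Finset.card_powerset])
  have hB' : ∀ i ∈ B.filter fun i => R i = A, r ≤ A.card ∧
      ∃ k ≤ P.len i, ∀ x ∈ A, P.word i k x := by
    intro i hi
    obtain ⟨hiB, hiA⟩ := Finset.mem_filter.mp hi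
    exact hiA ▸ hR i hiB
  generalize B.filter (fun i => R i = A) = B' at hcard hB'
  rcases Nat.eq_zero_or_pos r with rfl | hr
  · exact ⟨∅, ⟨⟨Equiv.equivOfIsEmpty _ _, fun {a} => isEmptyElim a⟩⟩⟩
  obtain ⟨i₀, hi₀⟩ := Finset.card_pos.mp (hr.trans_le hcard)
  have hAr := (hB' i₀ hi₀).1
  choose! k hk hkA using fun i hi => (hB' i hi).2
  obtain ⟨a⟩ : Nonempty (Fin r ↪ A) := Function.Embedding.nonempty_of_card_le (by simpa using hAr)
  obtain ⟨c⟩ : Nonempty (Fin r ↪ B') :=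
    Function.Embedding.nonempty_of_card_le (by simpa using hcard)
  have haS : ∀ u, (a u : V) ∈ S := fun u => hT _ (Finset.mem_powerset.mp hA (a u).2)
  refine _root_.hasInducedSubgraphIso_completeBipartiteGraph (fun u => (a u : V))
    (fun u => P.vert (c u) (k (c u))) (fun u v h => a.injective (Subtype.ext h)) ?_
    (fun u v => hstable _ (haS u) _ (haS v)) ?_ (fun u v => hkA _ (c v).2 _ (a u).2)
  · intro u v huv
    exact c.injective (Subtype.ext (P.inj _ _ _ _ (hk _ (c u).2) (hk _ (c v).2) huv).1)
  · intro u v huv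
    obtain ⟨h1, h2⟩ := (P.adj_iff _ _ _ _ (hk _ (c u).2) (hk _ (c v).2)).mp huv
    rw [h1] at h2
    omega

theorem exists_sitsIn_of_wordReducible [LinearOrder V] [Fintype V]
    (hstable : ∀ x ∈ S, ∀ y ∈ S, ¬ G.Adj x y) (e : ι → Set V) (he : Function.Injective e)
    (hmem : ∀ i, e i ∈ CompsOn G (Set.univ \ S))
    (hP : ∀ i v, v ∈ e i ↔ ∃ k ≤ P.len i, P.vert i k = v) {T : Finset V} (hTS : ∀ x ∈ T, x ∈ S)
    (hT : 0 < T.card) {J : Finset ι} {κ : Fin 3} {d q : ℕ}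
    (h : ∀ i ∈ J, WordReducible κ d q (P.word i) 0 (P.len i) T) :
    ∃ W' S' : Set V, IsConstellationOn G W' S' ∧ SitsIn G W' S' Set.univ S ∧ DAmple G W' S' d ∧
      (if κ = 2 then Zigzagged G W' S' q else Interrupted G W' S') ∧ S'.ncard = T.card ∧
      (CompsOn G (W' \ S')).ncard = J.card := by
  have hS' : (T : Set V) ⊆ S := hTS
  choose! lo hi _ hhi hmeet ham hkind using h
  have hlo : ∀ i ∈ (J : Set ι), lo i ≤ hi i := by
    intro i hi'
    obtain ⟨x, hx⟩ := Finset.card_pos.mp hT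
    obtain ⟨k, h1, h2, -⟩ := hmeet i hi' x hx
    exact h1.trans h2
  have hTmem : ∀ x, x ∈ T ↔ x ∈ (T : Set V) := fun x => Finset.mem_coe.symm
  refine ⟨T ∪ P.union J lo hi, T, P.isConstellationOn_union hS' hlo hhi hstable hmeet,
    P.sitsIn_union hS' hlo hhi e he hmem hP, P.dAmple_union hS' hhi hstable hTmem ham, ?_,
    Set.ncard_coe_finset T, ?_⟩
  · simp only [WordKind] at hkind
    split_ifs with hκ
    · subst hκ
      exact P.zigzagged_union hS' hhi hstable hTmem fun i hi' => by simpa using hkind i hi'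
    · obtain rfl | rfl : κ = 0 ∨ κ = 1 := by omega
      · exact P.interrupted_union_of_wordUp hS' hhi hstable hTmem
          fun i hi' => by simpa using hkind i hi'
      · exact P.interrupted_union_of_wordDown hS' hhi hstable hTmem
          fun i hi' => by simpa using hkind i hi'
  · rw [P.ncard_compsOn_union hS' hlo hhi, Set.ncard_coe_finset]

end PathSystem

/-- Theorem 2.1: for all positive `d, l, l', r, s, s', t` there are `f, g`
such that every `(f,g)`-constellation contains `K_{r,r}` or a proper subdivision of
`K_{2t+2}` as an induced subgraph, or a `d`-ample interrupted `(s,l)`-constellation sits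
in it, or a `d`-ample `2t`-zigzagged `(s',l')`-constellation sits in it. -/
theorem stmt1 (d l l' r s s' t : ℕ)
    (hd : 0 < d) (hl : 0 < l) (hl' : 0 < l') (hr : 0 < r)
    (hs : 0 < s) (hs' : 0 < s') (ht : 0 < t) :
    ∃ f g : ℕ, 0 < f ∧ 0 < g ∧
      ∀ (V : Type) [Fintype V] (G : SimpleGraph V) (S : Set V),
        IsConstellationOn G Set.univ S →
        S.ncard = f → (CompsOn G (Set.univ \ S)).ncard = g →
          (HasInducedSubgraphIso G (completeBipartiteGraph (Fin r) (Fin r)) ∨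
            ∃ X : Set V,
              IsSubdivisionWith (G.induce X) (⊤ : SimpleGraph (Fin (2 * t + 2)))
                (fun n => 2 ≤ n)) ∨
          (∃ W' S' : Set V, IsConstellationOn G W' S' ∧ SitsIn G W' S' Set.univ S ∧
              DAmple G W' S' d ∧ Interrupted G W' S' ∧
              S'.ncard = s ∧ (CompsOn G (W' \ S')).ncard = l) ∨
          (∃ W' S' : Set V, IsConstellationOn G W' S' ∧ SitsIn G W' S' Set.univ S ∧
              DAmple G W' S' d ∧ Zigzagged G W' S' (2 * t) ∧
              S'.ncard = s' ∧ (CompsOn G (W' \ S')).ncard = l') := by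
  classical
  choose F₁ hF₁ using exists_wordFull_or_wordMixed (2 * t)
  choose F₂ hF₂ using exists_wordReducible (2 * t) d r
  let m := 2 * t + 2
  let n₁ := F₂^[3 * (l + l')] (s + s') + m
  let g := m * m + (2 ^ n₁ * r + 3 * (l + l'))
  refine ⟨F₁^[g] n₁ + 1, g, Nat.succ_pos _, by positivity, fun V _ G S hG hf hg => ?_⟩
  let _ : LinearOrder V := LinearOrder.lift' (Fintype.equivFin V) (Fintype.equivFin V).injective
  obtain ⟨P, hP⟩ := exists_pathSystem hG
  have hstable := hG.stable
  have hcard : (Finset.univ : Finset (CompsOn G (Set.univ \ S))).card = g := by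
    rw [Finset.card_univ, ← Nat.card_eq_fintype_card]
    exact hg
  obtain ⟨S₁, hS₁, hc₁, h₁⟩ := exists_subset_forall_of_step
    (fun (_ : CompsOn G (Set.univ \ S)) (_ : Finset V) => True)
    (fun i T => (∀ T' ⊆ T, T'.card = m → WordFull (P.word i) 0 (P.len i) T') ∨
      WordMixed (P.word i) 0 (P.len i) T (2 * t) (2 * t) (2 * t))
    (fun _ _ _ _ _ => trivial)
    (fun i T T' hT h => h.imp (fun h U hU => h U (hU.trans hT)) fun h => h.mono hT le_rfl le_rfl)
    F₁ (fun N i T hT _ => hF₁ N V (P.word i) 0 (P.len i) T hT) g n₁ Finset.univ hcard S.toFinset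
    (by rw [← Set.ncard_eq_toFinset_card', hf]; omega) (fun _ _ => trivial)
  have hS₁S : ∀ x ∈ S₁, x ∈ S := fun x hx => Set.mem_toFinset.mp (hS₁ hx)
  let full := Finset.univ.filter fun i =>
    ∀ T' ⊆ S₁, T'.card = m → WordFull (P.word i) 0 (P.len i) T'
  by_cases hfull : m * m ≤ full.card
  · obtain ⟨T, hT, hTc⟩ := Finset.exists_subset_card_eq (show m ≤ S₁.card by omega)
    exact Or.inl (Or.inr (P.exists_isSubdivisionWith_of_wordFull hTc (fun x hx => hS₁S x (hT hx))
      hstable hfull fun i hi => (Finset.mem_filter.mp hi).2 T hT hTc))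
  let bad := fullᶜ.filter fun i => ∃ k ≤ P.len i, ∃ R ⊆ S₁, (∀ x ∈ R, P.word i k x) ∧ r ≤ R.card
  by_cases hbad : 2 ^ S₁.card * r ≤ bad.card
  · exact Or.inl (Or.inl (P.hasInducedSubgraphIso_completeBipartiteGraph hstable hS₁S hbad
      fun i hi => (Finset.mem_filter.mp hi).2))
  have hgood : 3 * (l + l') ≤ (fullᶜ \ bad).card := by
    have h1 := Finset.card_add_card_compl full
    rw [← Finset.card_univ, hcard] at h1
    have h2 := Finset.le_card_sdiff bad fullᶜ
    rw [hc₁] at hbad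
    omega
  obtain ⟨I, hI, hIc⟩ := Finset.exists_subset_card_eq hgood
  obtain ⟨S₂, hS₂, hc₂, h₂⟩ := exists_subset_forall_of_step
    (fun (i : CompsOn G (Set.univ \ S)) (T : Finset V) => (∀ x ∈ T, x ∈ S) ∧
      WordMixed (P.word i) 0 (P.len i) T (2 * t) (2 * t) (2 * t) ∧
      ∀ k, 0 ≤ k → k ≤ P.len i → ∀ R ⊆ T, (∀ x ∈ R, P.word i k x) → R.card ≤ r)
    (fun i T => ∃ κ, WordReducible κ d (2 * t) (P.word i) 0 (P.len i) T)
    (fun i T T' hT h => ⟨fun x hx => h.1 x (hT hx), h.2.1.mono hT le_rfl le_rfl,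
      fun k h0 hk R hR => h.2.2 k h0 hk R (hR.trans hT)⟩)
    (fun i T T' hT h => h.imp fun κ h => h.mono hT)
    F₂ (fun N i T hT h => hF₂ N V (P.word i) 0 (P.len i) T hT (fun x hx => by
      obtain ⟨y, hy, hxy⟩ := hG.dominates x (h.1 x hx) i i.2
      obtain ⟨k, hk, rfl⟩ := (hP i y).mp hy
      exact ⟨k, Nat.zero_le k, hk, hxy⟩) h.2.1 h.2.2)
    (3 * (l + l')) (s + s') I hIc S₁ (by omega) (fun i hi => by
      obtain ⟨hi1, hi2⟩ := Finset.mem_sdiff.mp (hI hi)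
      refine ⟨hS₁S, (h₁ i (Finset.mem_univ i)).resolve_left fun h => ?_, fun k _ hk R hR hkR => ?_⟩
      · exact Finset.mem_compl.mp hi1 (Finset.mem_filter.mpr ⟨Finset.mem_univ i, h⟩)
      · by_contra hlt
        exact hi2 (Finset.mem_filter.mpr ⟨hi1, k, hk, R, hR, hkR, by omega⟩))
  choose! κ hκ using h₂
  obtain ⟨c, -, hc⟩ := Finset.exists_le_card_fiber_of_mul_le_card_of_maps_to
    (s := I) (t := (Finset.univ : Finset (Fin 3))) (f := κ) (n := l + l')
    (fun i _ => Finset.mem_univ _) Finset.univ_nonempty (by simp [hIc])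
  have main : ∀ a b : ℕ, 0 < a → a ≤ s + s' → b ≤ l + l' →
      ∃ W' S' : Set V, IsConstellationOn G W' S' ∧ SitsIn G W' S' Set.univ S ∧ DAmple G W' S' d ∧
        (if c = 2 then Zigzagged G W' S' (2 * t) else Interrupted G W' S') ∧ S'.ncard = a ∧
        (CompsOn G (W' \ S')).ncard = b := by
    intro a b ha ha' hb
    obtain ⟨T, hT, rfl⟩ := Finset.exists_subset_card_eq (ha'.trans hc₂.ge)
    obtain ⟨J, hJ, rfl⟩ := Finset.exists_subset_card_eq (hb.trans hc)
    refine P.exists_sitsIn_of_wordReducible hstable Subtype.val Subtype.val_injective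
      (fun i => i.2) hP (fun x hx => hS₁S x (hS₂ (hT hx))) ha fun i hi => ?_
    obtain ⟨hi, rfl⟩ := Finset.mem_filter.mp (hJ hi)
    exact (hκ i hi).mono hT
  right
  by_cases h2 : c = 2
  · simp only [h2, if_true] at main
    exact Or.inr (main s' l' hs' (by omega) (by omega))
  · simp only [h2, if_false] at main
    exact Or.inl (main s l hs (by omega) (by omega))
end

section
/- For every integer n ≥ 2, the zigzag sequence Z_n contains no alignment of size 4. -/
open SimpleGraph

/-- Every contiguous part of `L` from a value `x` to a value `y` meets all values strictly
between `x` and `y`, and visits any two of those at least once in the order opposite to the one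
suggested by the direction from `x` to `y`. -/
def Backtracking (L : List ℤ) : Prop :=
  ∀ w x y, w <:+: L → w.head? = some x → w.getLast? = some y →
    (∀ b, x < b ∧ b < y ∨ y < b ∧ b < x → b ∈ w) ∧
    (∀ b c, x < b → b < c → c < y → [c, b].Sublist w) ∧
    (∀ b c, y < b → b < c → c < x → [b, c].Sublist w)

/-- A contiguous part of `P ++ m :: Q` lies on one side of the entry `m` or consists of a piece
ending at `m` and a piece starting at `m`. -/
theorem List.infix_append_cons_cases {α : Type*} {w P Q : List α} {m : α}
    (h : w <:+: P ++ m :: Q) :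
    w <:+: P ++ [m] ∨ w <:+: m :: Q ∨
      ∃ s t, w = s ++ m :: t ∧ s ++ [m] <:+: P ++ [m] ∧ t <+: Q := by
  rcases List.infix_append_iff.1 h with h | h | ⟨s, t, rfl, hs, ht⟩
  · exact Or.inl (h.trans (List.prefix_append P [m]).isInfix)
  · exact Or.inr (Or.inl h)
  · rcases List.prefix_cons_iff.1 ht with rfl | ⟨t, rfl, ht'⟩
    · left
      rw [List.append_nil]
      exact hs.isInfix.trans (List.prefix_append P [m]).isInfix
    · refine Or.inr (Or.inr ⟨s, t, rfl, ?_, ht'⟩)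
      obtain ⟨r, rfl⟩ := hs
      exact ⟨r, [], by simp⟩

theorem Backtracking.reverse {L : List ℤ} (h : Backtracking L) : Backtracking L.reverse := by
  intro w x y hw hx hy
  obtain ⟨h₁, h₂, h₃⟩ := h w.reverse y x (by simpa using List.reverse_infix.2 hw)
    (by simpa using hy) (by simpa using hx)
  refine ⟨fun b hb => by simpa using h₁ b hb.symm, fun b c hb hc hd => ?_, fun b c hb hc hd => ?_⟩
  · simpa using (h₃ b c hb hc hd).reverse
  · simpa using (h₂ b c hb hc hd).reverse

theorem Backtracking.map_add_one {L : List ℤ} (h : Backtracking L) :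
    Backtracking (L.map (· + 1)) := by
  intro w x y hw hx hy
  obtain ⟨w, hwL, rfl⟩ := List.infix_map_iff.1 hw
  simp only [List.head?_map, List.getLast?_map, Option.map_eq_some_iff] at hx hy
  obtain ⟨x, hx, rfl⟩ := hx
  obtain ⟨y, hy, rfl⟩ := hy
  obtain ⟨h₁, h₂, h₃⟩ := h w x y hwL hx hy
  have hshift {u v : ℤ} (h : [u - 1, v - 1].Sublist w) :
      [u, v].Sublist (w.map (· + 1)) := by
    have hmap := h.map (· + 1)
    rwa [List.map_cons, List.map_singleton, sub_add_cancel, sub_add_cancel] at hmap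
  refine ⟨fun b hb => ?_, fun b c hb hc hd => ?_, fun b c hb hc hd => ?_⟩
  · exact List.mem_map.2 ⟨b - 1, h₁ _ (by omega), by omega⟩
  · exact hshift (h₂ (b - 1) (c - 1) (by omega) (by omega) (by omega))
  · exact hshift (h₃ (b - 1) (c - 1) (by omega) (by omega) (by omega))

theorem Backtracking.append_of_le {P Q : List ℤ} {m : ℤ} (hP : Backtracking (P ++ [m]))
    (hQ : Backtracking (m :: Q)) (hmP : ∀ x ∈ P ++ [m], m ≤ x) (hmQ : ∀ x ∈ m :: Q, m ≤ x) :
    Backtracking (P ++ m :: Q) := by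
  intro w x y hw hx hy
  rcases List.infix_append_cons_cases hw with hw | hw | ⟨s, t, rfl, hs, ht⟩
  · exact hP w x y hw hx hy
  · exact hQ w x y hw hx hy
  have ht' : m :: t <+: m :: Q := (List.prefix_cons_inj m).2 ht
  have hsx : (s ++ [m]).head? = some x := by
    cases s <;> simpa using hx
  have hty : (m :: t).getLast? = some y := by
    simpa [List.getLast?_append] using hy
  have hxm : m ≤ x := hmP x (hs.subset (List.mem_of_mem_head? hsx))
  have hym : m ≤ y := hmQ y (ht'.subset (List.mem_of_mem_getLast? hty))
  have hsw : (s ++ [m]).Sublist (s ++ m :: t) := by simp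
  have htw : (m :: t).Sublist (s ++ m :: t) := by simp
  obtain ⟨a₁, -, a₃⟩ := hP _ x m hs hsx (by simp)
  obtain ⟨c₁, c₂, -⟩ := hQ _ m y ht'.isInfix rfl hty
  refine ⟨fun b hb => ?_, fun b c hb hc hd => ?_, fun b c hb hc hd => ?_⟩
  · rcases hb with hb | hb
    · exact htw.subset (c₁ b (by omega))
    · exact hsw.subset (a₁ b (by omega))
  · exact (c₂ b c (by omega) hc hd).trans htw
  · exact (a₃ b c (by omega) hc hd).trans hsw

theorem Backtracking.append_of_ge {P Q : List ℤ} {l m : ℤ} (hP : Backtracking (P ++ [m]))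
    (hQ : Backtracking (m :: Q)) (hmP : ∀ x ∈ P ++ [m], l ≤ x ∧ x ≤ m)
    (hmQ : ∀ x ∈ m :: Q, x ≤ m + 1)
    (hlQ : ∀ t, t <+: Q → (m :: t).getLast? = some (m + 1) → ∀ b, l < b → b < m → b ∈ t) :
    Backtracking (P ++ m :: Q) := by
  intro w x y hw hx hy
  rcases List.infix_append_cons_cases hw with hw | hw | ⟨s, t, rfl, hs, ht⟩
  · exact hP w x y hw hx hy
  · exact hQ w x y hw hx hy
  have ht' : m :: t <+: m :: Q := (List.prefix_cons_inj m).2 ht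
  have hsx : (s ++ [m]).head? = some x := by
    cases s <;> simpa using hx
  have hty : (m :: t).getLast? = some y := by
    simpa [List.getLast?_append] using hy
  have hxm := hmP x (hs.subset (List.mem_of_mem_head? hsx))
  have hym : y ≤ m + 1 := hmQ y (ht'.subset (List.mem_of_mem_getLast? hty))
  have hsw : (s ++ [m]).Sublist (s ++ m :: t) := by simp
  have htw : (m :: t).Sublist (s ++ m :: t) := by simp
  obtain ⟨a₁, a₂, -⟩ := hP _ x m hs hsx (by simp)
  obtain ⟨c₁, -, c₃⟩ := hQ _ m y ht'.isInfix rfl hty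
  refine ⟨fun b hb => ?_, fun b c hb hc hd => ?_, fun b c hb hc hd => ?_⟩
  · rcases lt_trichotomy b m with hbm | rfl | hbm
    · rcases hb with hb | hb
      · exact hsw.subset (a₁ b (by omega))
      · exact htw.subset (c₁ b (by omega))
    · simp
    · exact htw.subset (c₁ b (by omega))
  · rcases lt_or_ge c m with hcm | hcm
    · exact (a₂ b c hb hc hcm).trans hsw
    · obtain rfl : c = m := by omega
      obtain rfl : y = c + 1 := by omega
      refine List.Sublist.trans ?_ htw
      simpa using hlQ t ht hty b (by omega) hc
  · exact (c₃ b c hb hc (by omega)).trans htw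

theorem backtracking_pair (x : ℤ) : Backtracking [x, x + 1] := by
  intro w a b hw ha hb
  have ha' := hw.subset (List.mem_of_mem_head? ha)
  have hb' := hw.subset (List.mem_of_mem_getLast? hb)
  simp only [List.mem_cons, List.not_mem_nil, or_false] at ha' hb'
  exact ⟨by intros; omega, by intros; omega, by intros; omega⟩

/-- `L` is a backtracking sequence from `1` to `n` with values in `[1, n]`. -/
structure IsZigzag (n : ℤ) (L : List ℤ) : Prop where
  backtracking : Backtracking L
  head : L.head? = some 1
  last : L.getLast? = some n
  bounds : ∀ x ∈ L, 1 ≤ x ∧ x ≤ n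

theorem isZigzag_two : IsZigzag 2 [1, 2] :=
  ⟨backtracking_pair 1, rfl, rfl, by simp⟩

theorem isZigzag_three : IsZigzag 3 [1, 2, 3] := by
  refine ⟨?_, rfl, rfl, by simp⟩
  exact (backtracking_pair 1).append_of_ge (P := [1]) (l := 1) (m := 2) (backtracking_pair 2)
    (by simp) (by simp) (by intros; omega)

/-- The recursion that defines the zigzag sequences preserves `IsZigzag`. -/
theorem IsZigzag.step {n : ℤ} {X S : List ℤ} (hn : 2 ≤ n) (hX : IsZigzag (n + 1) X)
    (hS : IsZigzag n S) :
    IsZigzag (n + 2)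
      (X.dropLast ++ ((S.map (· + 1)).reverse).dropLast ++ X.map (· + 1)) := by
  obtain ⟨X₁, hX₁⟩ := List.head?_eq_some_iff.1 hX.head
  obtain ⟨X₂, hX₂⟩ := List.getLast?_eq_some_iff.1 hX.last
  obtain ⟨M, hM⟩ : ∃ M, S = 1 :: (M ++ [n]) := by
    obtain ⟨S₁, hS₁⟩ := List.head?_eq_some_iff.1 hS.head
    have hl := hS.last
    rw [hS₁] at hl
    rcases S₁.eq_nil_or_concat with rfl | ⟨M, z, rfl⟩
    · simp at hl; omega
    · refine ⟨M, ?_⟩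
      obtain rfl : z = n := by simpa [List.getLast?_cons] using hl
      simpa using hS₁
  obtain ⟨N, hN⟩ : ∃ N, N = (M.map (· + 1)).reverse := ⟨_, rfl⟩
  obtain ⟨W, hW⟩ : ∃ W, W = X₁.map (· + 1) := ⟨_, rfl⟩
  have hXW : X.map (· + 1) = 2 :: W := by simp [hX₁, hW]
  have hSN : (S.map (· + 1)).reverse = (n + 1) :: (N ++ [2]) := by simp [hM, hN]
  have hdesc := hS.backtracking.map_add_one.reverse
  have hdesc_bd : ∀ x ∈ (S.map (· + 1)).reverse, 2 ≤ x ∧ x ≤ n + 1 := by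
    intro x hx
    simp only [List.mem_reverse, List.mem_map] at hx
    obtain ⟨z, hz, rfl⟩ := hx
    have := hS.bounds z hz
    omega
  have hasc := hX.backtracking.map_add_one
  have hasc_bd : ∀ x ∈ X.map (· + 1), 2 ≤ x ∧ x ≤ n + 2 := by
    intro x hx
    obtain ⟨z, hz, rfl⟩ := List.mem_map.1 hx
    have := hX.bounds z hz
    omega
  have hasc_last : (X.map (· + 1)).getLast? = some (n + 2) := by
    rw [List.getLast?_map, hX.last]
    simp only [Option.map_some, Option.some.injEq]
    omega
  have hXbt := hX.backtracking
  have hXbd := hX.bounds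
  have hXhead := hX.head
  rw [hSN] at hdesc hdesc_bd
  rw [hXW] at hasc hasc_bd hasc_last
  have hshape : X.dropLast ++ ((S.map (· + 1)).reverse).dropLast ++ X.map (· + 1) =
      X₂ ++ (n + 1) :: (N ++ 2 :: W) := by
    rw [hSN, hXW, ← List.cons_append, List.dropLast_concat, hX₂, List.dropLast_concat]
    simp
  rw [hshape]
  rw [hX₂] at hXbt hXbd hXhead
  have htail : Backtracking ((n + 1) :: (N ++ 2 :: W)) := by
    rw [← List.cons_append] at hdesc hdesc_bd ⊢
    exact hdesc.append_of_le hasc (fun x hx => (hdesc_bd x hx).1) (fun x hx => (hasc_bd x hx).1)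
  have hbd : ∀ x ∈ (n + 1) :: (N ++ 2 :: W), 2 ≤ x ∧ x ≤ n + 2 := by
    intro x hx
    have h : x ∈ (n + 1) :: (N ++ [2]) ∨ x ∈ 2 :: W := by
      simp only [List.mem_cons, List.mem_append] at hx ⊢
      tauto
    rcases h with h | h
    · have := hdesc_bd x h
      omega
    · exact hasc_bd x h
  refine ⟨?_, ?_, ?_, ?_⟩
  · refine hXbt.append_of_ge (l := 1) htail hXbd (fun x hx => by have := hbd x hx; omega) ?_
    intro t ht hlast b hb hbn
    rcases List.prefix_or_prefix_of_prefix ht (List.prefix_append N (2 :: W)) with htN | ⟨r, rfl⟩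
    · have := hdesc_bd _ (((List.prefix_cons_inj (n + 1)).2
        (htN.trans (List.prefix_append N [2]))).subset (List.mem_of_mem_getLast? hlast))
      omega
    · rcases List.prefix_cons_iff.1 ((List.prefix_append_right_inj N).1 ht) with rfl | ⟨r, rfl, -⟩
      · have := hdesc_bd (n + 1 + 1) (((List.prefix_cons_inj (n + 1)).2
          (by simp)).subset (List.mem_of_mem_getLast? hlast))
        omega
      · rcases eq_or_ne b 2 with rfl | hb2
        · simp
        · have := (hdesc _ (n + 1) 2 List.infix_rfl rfl (by simp [List.getLast?_cons])).1 b
            (by omega)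
          simp only [List.mem_cons, List.mem_append, List.not_mem_nil, or_false] at this ⊢
          grind
  · cases X₂ <;> simpa using hXhead
  · rw [← hasc_last]
    simp [List.getLast?_append, List.getLast?_cons]
  · intro x hx
    have h : x ∈ X₂ ++ [n + 1] ∨ x ∈ (n + 1) :: (N ++ 2 :: W) := by
      simp only [List.mem_cons, List.mem_append] at hx ⊢
      tauto
    rcases h with h | h
    · have := hXbd x h
      omega
    · have := hbd x h
      omega

theorem isZigzag_zseq : ∀ n : ℕ, IsZigzag (n + 2) (Zseq (n + 2))
  | 0 => by simpa [Zseq] using isZigzag_two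
  | 1 => by simpa [Zseq] using isZigzag_three
  | n + 2 => by
    have h₁ := isZigzag_zseq (n + 1)
    have h₂ := isZigzag_zseq n
    have h := IsZigzag.step (n := n + 2) (by omega) (by convert h₁ using 1; push_cast; ring) h₂
    rw [show n + 2 + 2 = n + 4 from rfl, Zseq]
    convert h using 1
    push_cast
    ring

/-- Going from `x` to `y`, a backtracking sequence visits some value strictly in between, then a
second one, then the first one again. -/
theorem Backtracking.exists_sublist {L w : List ℤ} (hL : Backtracking L) {x y b c : ℤ}
    (hw : w <:+: L) (hx : w.head? = some x) (hy : w.getLast? = some y)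
    (h : x < b ∧ b < c ∧ c < y ∨ y < c ∧ c < b ∧ b < x) : [b, c, b].Sublist w := by
  obtain ⟨-, h₂, h₃⟩ := hL w x y hw hx hy
  have hcb : [c, b].Sublist w := by
    rcases h with ⟨h, h', h''⟩ | ⟨h, h', h''⟩
    · exact h₂ b c h h' h''
    · exact h₃ c b h h' h''
  obtain ⟨p, q, rfl, hp, hq⟩ := List.cons_sublist_iff.1 hcb
  obtain ⟨s, t, rfl⟩ := List.append_of_mem hp
  have hb : b ∈ s ++ [c] := by
    refine (hL (s ++ [c]) x c (List.IsInfix.trans ⟨[], t ++ q, by simp⟩ hw) ?_ (by simp)).1 b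
      (by omega)
    cases s <;> simpa using hx
  have hbs : b ∈ s := by
    simp only [List.mem_append, List.mem_singleton] at hb
    rcases hb with hb | hb
    · exact hb
    · omega
  have hbs : [b].Sublist s := List.singleton_sublist.2 hbs
  simpa using hbs.append (List.Sublist.cons_cons c (hq.trans (List.sublist_append_right t q)))

/-- Two members of a list are the two ends, in some order, of a contiguous part of it. -/
theorem List.exists_infix_of_mem {α : Type*} {L : List α} {x y : α} (hx : x ∈ L) (hy : y ∈ L) :
    ∃ w, w <:+: L ∧ (w.head? = some x ∧ w.getLast? = some y ∨
      w.head? = some y ∧ w.getLast? = some x) := by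
  obtain ⟨p, q, rfl⟩ := List.append_of_mem hx
  rcases List.mem_append.1 hy with hy | hy
  · obtain ⟨s, t, rfl⟩ := List.append_of_mem hy
    exact ⟨y :: t ++ [x], ⟨s, q, by simp⟩, Or.inr ⟨rfl, List.getLast?_concat⟩⟩
  · obtain ⟨s, t, hst⟩ := List.append_of_mem hy
    cases s with
    | nil =>
      obtain ⟨rfl, rfl⟩ : x = y ∧ q = t := by simpa using hst
      exact ⟨[x], ⟨p, q, by simp⟩, Or.inl ⟨rfl, rfl⟩⟩
    | cons z s =>
      obtain ⟨rfl, rfl⟩ : x = z ∧ q = s ++ y :: t := by simpa using hst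
      exact ⟨x :: s ++ [y], ⟨p, t, by simp⟩, Or.inl ⟨rfl, List.getLast?_concat⟩⟩

theorem List.IsChain.sublist_destutter'_ne {α : Type*} [DecidableEq α] {s : List α}
    (hs : s.IsChain (· ≠ ·)) {l : List α} {a : α} (h : s.Sublist (a :: l)) :
    s.Sublist (l.destutter' (· ≠ ·) a) := by
  induction l generalizing a s with
  | nil => simpa using h
  | cons x l ih =>
    by_cases hax : a = x
    · subst hax
      rw [List.destutter'_cons_neg _ (by simp)]
      refine ih hs ?_
      rcases List.sublist_cons_iff.1 h with h | ⟨t, rfl, ht⟩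
      · exact h
      · rcases List.sublist_cons_iff.1 ht with ht | ⟨r, rfl, -⟩
        · exact ht.cons_cons a
        · simp at hs
    · rw [List.destutter'_cons_pos _ hax]
      rcases List.sublist_cons_iff.1 h with h | ⟨t, rfl, ht⟩
      · exact (ih hs h).cons a
      · exact (ih hs.tail ht).cons_cons a

theorem List.IsChain.sublist_collapse {s l : List ℤ} (hs : s.IsChain (· ≠ ·))
    (h : s.Sublist l) : s.Sublist (collapse l) := by
  cases l with
  | nil => simpa [collapse] using h
  | cons a l => exact hs.sublist_destutter'_ne h

theorem Finset.exists_lt_of_card_eq_four {B : Finset ℤ} (hB : B.card = 4) :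
    ∃ a ∈ B, ∃ b ∈ B, ∃ c ∈ B, ∃ d ∈ B, a < b ∧ b < c ∧ c < d := by
  have hmono := (B.orderEmbOfFin hB).strictMono
  have hmem := B.orderEmbOfFin_mem hB
  exact ⟨_, hmem 0, _, hmem 1, _, hmem 2, _, hmem 3, hmono (by decide), hmono (by decide),
    hmono (by decide)⟩

/-- Lemma 3.1: the zigzag sequence `Z_n` contains no alignment of size 4. -/
theorem stmt3 (n : ℕ) (hn : 2 ≤ n) (B : Finset ℤ) (hB : B.card = 4) :
    ¬ IsAlignment (Zseq n) B := by
  rintro ⟨-, i, j, -, -, hcount⟩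
  obtain ⟨k, rfl⟩ := Nat.exists_eq_add_of_le' hn
  have hbt := (isZigzag_zseq k).backtracking
  obtain ⟨I, hI⟩ : ∃ I, I = ((Zseq (k + 2)).take (j + 1)).drop i := ⟨_, rfl⟩
  have hIL : I <:+: Zseq (k + 2) := by
    rw [hI]
    exact (List.drop_suffix _ _).isInfix.trans (List.take_prefix _ _).isInfix
  rw [← hI] at hcount
  have hmem : ∀ b ∈ B, b ∈ I := fun b hb =>
    (List.mem_filter.1 ((List.destutter_sublist _ _).subset
      (List.count_pos_iff.1 (by rw [← collapse, hcount b hb]; exact one_pos)))).1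
  have hno : ∀ b ∈ B, ∀ c ∈ B, b ≠ c → ¬ [b, c, b].Sublist I := by
    intro b hb c hc hbc h
    have hf : [b, c, b].Sublist (I.filter (fun a => decide (a ∈ B))) := by
      simpa [hb, hc] using h.filter (fun a => decide (a ∈ B))
    have hchain : [b, c, b].IsChain (· ≠ ·) := by simp [hbc, hbc.symm]
    have hle := (hchain.sublist_collapse hf).count_le b
    rw [hcount b hb] at hle
    simp [hbc.symm] at hle
  obtain ⟨a, ha, b, hb, c, hc, d, hd, hab, hbc, hcd⟩ := Finset.exists_lt_of_card_eq_four hB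
  obtain ⟨w, hw, ⟨hx, hy⟩ | ⟨hx, hy⟩⟩ := List.exists_infix_of_mem (hmem a ha) (hmem d hd)
  · exact hno b hb c hc hbc.ne
      ((hbt.exists_sublist (hw.trans hIL) hx hy (by omega)).trans hw.sublist)
  · exact hno c hc b hb hbc.ne'
      ((hbt.exists_sublist (hw.trans hIL) hx hy (by omega)).trans hw.sublist)
end

section
/- For every integer n ≥ 2, the zigzag sequence Z_n is smooth, and the set of values occurring in Z_n is exactly {1, 2, …, n}. -/
open SimpleGraph

/-- Smoothness of a list of integers is preserved by translation by `1`. -/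
theorem isChain_map_add_one {l : List ℤ} (h : l.IsChain (fun a b : ℤ => |a - b| ≤ 1)) :
    (l.map (· + 1)).IsChain (fun a b : ℤ => |a - b| ≤ 1) := by
  rw [List.isChain_map]
  simpa using h

/-- Smoothness of a list of integers is preserved by reversal. -/
theorem isChain_reverse_of_isChain {l : List ℤ} (h : l.IsChain (fun a b : ℤ => |a - b| ≤ 1)) :
    l.reverse.IsChain (fun a b : ℤ => |a - b| ≤ 1) := by
  rw [List.isChain_reverse]
  simpa only [abs_sub_comm, flip] using h

/-- A smooth list from `1` to `c` whose set of values is `{1, …, c}`. -/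
def IsSmoothFromOneTo (c : ℤ) (l : List ℤ) : Prop :=
  (∃ m, l = 1 :: (m ++ [c])) ∧ l.IsChain (fun a b : ℤ => |a - b| ≤ 1) ∧
    ∀ a, a ∈ l ↔ 1 ≤ a ∧ a ≤ c

theorem IsSmoothFromOneTo.zigzag {c : ℤ} {k l : List ℤ} (hk : IsSmoothFromOneTo c k)
    (hl : IsSmoothFromOneTo (c + 1) l) :
    IsSmoothFromOneTo (c + 2)
      (l.dropLast ++ ((k.map (· + 1)).reverse).dropLast ++ l.map (· + 1)) := by
  obtain ⟨⟨p, rfl⟩, hkc, hkm⟩ := hk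
  obtain ⟨⟨m, rfl⟩, hlc, hlm⟩ := hl
  have hrev := isChain_reverse_of_isChain (isChain_map_add_one hkc)
  have hshift := isChain_map_add_one hlc
  have heq : (1 :: (m ++ [c + 1])).dropLast ++
      (((1 :: (p ++ [c])).map (· + 1)).reverse).dropLast ++ (1 :: (m ++ [c + 1])).map (· + 1) =
      (1 :: m) ++ (c + 1) :: ((p.map (· + 1)).reverse ++
        (1 + 1) :: (m.map (· + 1) ++ [c + 1 + 1])) := by
    rw [← List.cons_append, List.dropLast_concat]
    simp [List.dropLast_cons_of_ne_nil, List.dropLast_append_of_ne_nil]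
  have hc : c + 1 + 1 = c + 2 := by ring
  rw [heq]
  refine ⟨⟨m ++ (c + 1) :: ((p.map (· + 1)).reverse ++ (1 + 1) :: m.map (· + 1)), ?_⟩, ?_, ?_⟩
  · simp [hc]
  · refine List.isChain_split.2 ⟨hlc, ?_⟩
    rw [← List.cons_append]
    exact List.isChain_split.2 ⟨by simpa using hrev, by simpa using hshift⟩
  · intro a
    have h₁ := hlm a
    have h₂ := hlm (a - 1)
    have h₃ := hkm (a - 1)
    have h₄ := hkm 1
    simp only [List.mem_cons, List.mem_append, List.mem_reverse, List.mem_map, List.not_mem_nil,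
      or_false, ← eq_sub_iff_add_eq, exists_eq_right, true_or, true_iff] at h₁ h₂ h₃ h₄ ⊢
    grind

theorem isSmoothFromOneTo_zseq (n : ℕ) : IsSmoothFromOneTo (n + 2 : ℕ) (Zseq (n + 2)) := by
  induction n using Nat.twoStepInduction with
  | zero =>
    refine ⟨⟨[], rfl⟩, by simp [Zseq], fun a => ?_⟩
    simp [Zseq]
    omega
  | one =>
    refine ⟨⟨[2], rfl⟩, by simp [Zseq], fun a => ?_⟩
    simp [Zseq]
    omega
  | more n ih₁ ih₂ =>
    have h := IsSmoothFromOneTo.zigzag ih₁ (l := Zseq (n + 3)) (by exact_mod_cast ih₂)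
    rw [show n + 2 + 2 = n + 4 from rfl, Zseq]
    exact_mod_cast h

/-- for `n ≥ 2`, the zigzag sequence `Z_n` is smooth and its set of values
is exactly `{1, …, n}`. -/
theorem stmt4 (n : ℕ) (hn : 2 ≤ n) :
    List.Chain' (fun a b : ℤ => |a - b| ≤ 1) (Zseq n) ∧
    {a : ℤ | a ∈ Zseq n} = Set.Icc (1 : ℤ) (n : ℤ) := by
  obtain ⟨k, rfl⟩ := Nat.exists_eq_add_of_le' hn
  obtain ⟨-, hchain, hmem⟩ := isSmoothFromOneTo_zseq k
  exact ⟨hchain, Set.ext hmem⟩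
end

section
/- For every integer n ≥ 2, replacing each entry a of the zigzag sequence Z_n by n+1−a yields the reverse sequence (Z_n)^{-1}. -/
open SimpleGraph

theorem Zseq_add_four (n : ℕ) :
    Zseq (n + 4) = (Zseq (n + 3)).dropLast ++ (((Zseq (n + 2)).map (· + 1)).reverse).dropLast
      ++ (Zseq (n + 3)).map (· + 1) := by
  rw [Zseq]

/-- For `n ≥ 2`, the sequence `Z_n` starts with `1` and ends with `n`. -/
theorem exists_Zseq_eq_cons_append (n : ℕ) :
    ∃ L : List ℤ, Zseq (n + 2) = 1 :: (L ++ [(n : ℤ) + 2]) := by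
  match n with
  | 0 => exact ⟨[], by simp [Zseq]⟩
  | 1 => exact ⟨[2], by simp [Zseq]⟩
  | n + 2 =>
    obtain ⟨L, hL⟩ := exists_Zseq_eq_cons_append (n + 1)
    refine ⟨L ++ (((Zseq (n + 2)).map (· + 1)).reverse).dropLast ++ (1 :: L).map (· + 1), ?_⟩
    rw [Zseq_add_four, hL, ← List.cons_append, List.dropLast_concat]
    simp
    ring

/-- The two ways of gluing three lists along a shared entry `x` of the first two and a shared
entry `y` of the last two agree. -/
theorem dropLast_append_dropLast_append {α : Type*} (P Q R : List α) (x y : α) :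
    (P ++ [x]).dropLast ++ (x :: (Q ++ [y])).dropLast ++ y :: R
      = (P ++ [x]) ++ (x :: (Q ++ [y])).tail ++ (y :: R).tail := by
  rw [← List.cons_append, List.dropLast_concat, List.dropLast_concat]
  simp

/-- for `n ≥ 2`, replacing each entry `a` of `Z_n` by `n + 1 - a` yields
the reverse sequence `(Z_n)⁻¹`. -/
theorem stmt5 (n : ℕ) (hn : 2 ≤ n) :
    (Zseq n).map (fun a => (n : ℤ) + 1 - a) = (Zseq n).reverse := by
  match n, hn with
  | 2, _ => simp [Zseq]
  | 3, _ => simp [Zseq]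
  | n + 4, _ =>
    have hA := stmt5 (n + 3) (by omega)
    have hB := stmt5 (n + 2) (by omega)
    obtain ⟨L, hL⟩ := exists_Zseq_eq_cons_append (n + 1)
    obtain ⟨M, hM⟩ := exists_Zseq_eq_cons_append n
    have hA₁ : (Zseq (n + 3)).map (fun a => ((n + 4 : ℕ) : ℤ) + 1 - a)
        = ((Zseq (n + 3)).map (· + 1)).reverse := by
      rw [← List.map_reverse, ← hA, List.map_map]
      exact List.map_congr_left fun a _ => by simp; ring
    have hA₂ : ((Zseq (n + 3)).map (· + 1)).map (fun a => ((n + 4 : ℕ) : ℤ) + 1 - a)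
        = (Zseq (n + 3)).reverse := by
      rw [← hA, List.map_map]
      exact List.map_congr_left fun a _ => by simp; ring
    have hB₁ : ((Zseq (n + 2)).map (· + 1)).reverse.map (fun a => ((n + 4 : ℕ) : ℤ) + 1 - a)
        = (Zseq (n + 2)).map (· + 1) := by
      rw [← List.map_reverse, ← hB, List.map_map, List.map_map]
      exact List.map_congr_left fun a _ => by simp; ring
    rw [Zseq_add_four, List.map_append, List.map_append, List.map_dropLast, List.map_dropLast,
      hA₁, hA₂, hB₁]
    have h := dropLast_append_dropLast_append (α := ℤ) ((L ++ [(n : ℤ) + 3]).map (· + 1)).reverse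
      (M.map (· + 1)) (L.reverse ++ [1]) 2 ((n : ℤ) + 3)
    have hA₃ : Zseq (n + 3) = 1 :: (L ++ [(n : ℤ) + 3]) := by
      rw [hL]; simp; ring
    have hA₄ : (Zseq (n + 3)).reverse = (n + 3 : ℤ) :: (L.reverse ++ [1]) := by
      simp [hA₃]
    have hA₅ : ((Zseq (n + 3)).map (· + 1)).reverse
        = ((L ++ [(n : ℤ) + 3]).map (· + 1)).reverse ++ [2] := by
      simp [hA₃]
    have hB₂ : (Zseq (n + 2)).map (· + 1) = 2 :: (M.map (· + 1) ++ [(n : ℤ) + 3]) := by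
      rw [hM]; simp; ring
    rw [← hA₅, ← hB₂, ← hA₄] at h
    rw [h, List.reverse_append, List.reverse_append, ← List.tail_reverse, ← List.tail_reverse,
      List.reverse_reverse, List.append_assoc]
end
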